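/- arXiv:1612.00661 — 2 statements merged into one kernel-verified Lean document; each statement's English description precedes it below -/
import Mathlib

section
/- (Balancing lemma.) For all integers k ≥ 1, r₁, Δ ≥ 1 and reals γ, d > 0 and 0 < ε < min{d, 1/(2k)} there exist ξ > 0 and C* > 0 such that the following holds for every p ≥ C*(log n/n)^{1/2} and every 10γ^{−1} ≤ r ≤ r₁, provided n is large enough. Let Γ be a graph on vertex set [n] and G ⊆ Γ a (not necessarily spanning) subgraph with vertex partition V = {V_{i,j}}_{i∈[r],j∈[k]} satisfying n/(8kr) ≤ |V_{i,j}| ≤ 4n/(kr) for each i, j. Let {n_{i,j}} be an integer partition of Σ|V_{i,j}|, and let R^k_r be a graph on [r]×[k] with δ(R^k_r) ≥ ((k−1)/k + γ/2)kr and K^k_r ⊆ B^k_r ⊆ R^k_r. Suppose for each i ∈ [r], j ≠ j' ∈ [k], v ∈ V: (B1) n_{i,j} − ξn ≤ |V_{i,j}| ≤ n_{i,j} + ξn; (B2) V is (ε/4,d,p)_G-lower-regular on R^k_r and (ε/4,d,p)_G-super-regular on K^k_r; (B3) both (N_Γ(v,V_{i,j}), V_{i,j'}) and (N_Γ(v,V_{i,j}),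 N_Γ(v,V_{i,j'})) are (ε/4,d,p)_G-lower-regular; (B4) |N_Γ(v,V_{i,j})| = (1 ± ε/4)p|V_{i,j}|. Then there exists a partition V' = {V'_{i,j}} of V such that for each i ∈ [r], j ≠ j' ∈ [k], v ∈ V: (B'1) |V'_{i,j}| = n_{i,j}; (B'2) |V_{i,j} △ V'_{i,j}| ≤ 10^{−10}ε⁴k^{−2}r₁^{−2}n; (B'3) V' is (ε,d,p)_G-lower-regular on R^k_r and (ε,d,p)_G-super-regular on K^k_r; (B'4) both (N_Γ(v,V'_{i,j}), V'_{i,j'}) and (N_Γ(v,V'_{i,j}), N_Γ(v,V'_{i,j'})) are (ε,d,p)_G-lower-regular; (B'5) for each 1 ≤ s ≤ Δ and vertices v₁,…,v_s ∈ [n], |N_Γ(v₁,…,v_s; V_{i,j}) △ N_Γ(v₁,…,v_s; V'_{i,j})| ≤ 10^{−10}ε⁴k^{−2}r₁^{−2}·deg_Γ(v₁,…,v_s) + C* log n. Furthermore, if for any two disjoint A, A' ⊆ V(Γ) with |A|, |A'| ≥ ε²ξpn/(50000kr₁) we have e_Γ(A,A') ≤ (1 + ε²ξ/100)p|A||A'|,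 and 'lower-regular' is replaced by 'regular' in (B2) and (B3), then 'lower-regular' may be replaced by 'regular' in (B'3) and (B'4). -/
open Filter

noncomputable section

/-- Number of ordered pairs `(x, y)` with `x ∈ X`, `y ∈ Y` adjacent in `G`;
for disjoint `X`, `Y` this is the number of edges of `G` between `X` and `Y`. -/
def eXY {n : ℕ} (G : SimpleGraph (Fin n)) (X Y : Finset (Fin n)) : ℕ :=
  Nat.card {q : Fin n × Fin n // q.1 ∈ X ∧ q.2 ∈ Y ∧ G.Adj q.1 q.2}

/-- Number of edges of `G` inside `X`. -/
def eIn {n : ℕ} (G : SimpleGraph (Fin n)) (X : Finset (Fin n)) : ℕ := eXY G X X / 2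

/-- The neighbourhood of `v` in `G` restricted to `U`. -/
def nbhdIn {n : ℕ} (G : SimpleGraph (Fin n)) (v : Fin n) (U : Finset (Fin n)) :
    Finset (Fin n) :=
  @Finset.filter _ (fun u => G.Adj v u) (fun _ => Classical.propDecidable _) U

/-- Common neighbourhood of `{w j : j ∈ Λ}` in `G`, restricted to `U`. -/
def commonNbhd {n s : ℕ} (G : SimpleGraph (Fin n)) (w : Fin s → Fin n)
    (Λ : Finset (Fin s)) (U : Finset (Fin n)) : Finset (Fin n) :=
  @Finset.filter _ (fun u => ∀ j ∈ Λ, G.Adj (w j) u) (fun _ => Classical.propDecidable _) U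

/-- The degree of `v` in `G`. -/
def degV {V : Type*} (G : SimpleGraph V) (v : V) : ℕ := Nat.card (G.neighborSet v)

/-- The minimum degree of `G` is at least `x`. -/
def MinDegGe {V : Type*} (G : SimpleGraph V) (x : ℝ) : Prop := ∀ v, x ≤ (degV G v : ℝ)

/-- The maximum degree of `G` is at most `D`. -/
def MaxDegLe {V : Type*} (G : SimpleGraph V) (D : ℕ) : Prop := ∀ v, degV G v ≤ D

/-- `H` has a labelling of its `n` vertices by `1, …, n` in which the endpoints of
every edge are at distance at most `b`. -/
def HasBandwidthLe {n : ℕ} (H : SimpleGraph (Fin n)) (b : ℝ) : Prop :=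
  ∃ L : Equiv.Perm (Fin n), ∀ u v, H.Adj u v → |((L u : ℕ) : ℝ) - ((L v : ℕ) : ℝ)| ≤ b

/-- `v` lies in a triangle of `H`. -/
def InTriangle {n : ℕ} (H : SimpleGraph (Fin n)) (v : Fin n) : Prop :=
  ∃ u w, H.Adj v u ∧ H.Adj v w ∧ H.Adj u w

/-- `v` lies in a four-cycle of `H`. -/
def InC4 {n : ℕ} (H : SimpleGraph (Fin n)) (v : Fin n) : Prop :=
  ∃ a b c, v ≠ b ∧ a ≠ c ∧ H.Adj v a ∧ H.Adj a b ∧ H.Adj b c ∧ H.Adj c v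

/-- `H` has degeneracy at most `D`: every (induced) subgraph has a vertex of degree
at most `D`. -/
def DegeneracyLe {n : ℕ} (H : SimpleGraph (Fin n)) (D : ℕ) : Prop :=
  ∀ A : Finset (Fin n), A.Nonempty → ∃ v ∈ A, (nbhdIn H v A).card ≤ D

/-- `G` contains a copy of `H`. -/
def ContainsCopy {n m : ℕ} (G : SimpleGraph (Fin n)) (H : SimpleGraph (Fin m)) : Prop :=
  ∃ f : Fin m → Fin n, Function.Injective f ∧ ∀ u v, H.Adj u v → G.Adj (f u) (f v)

open Classical in
/-- The probability that the binomial random graph `G(n,p)` has the property `Q`. -/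
def gnpProb (n : ℕ) (p : ℝ) (Q : SimpleGraph (Fin n) → Prop) : ℝ :=
  ∑ G : SimpleGraph (Fin n),
    if Q G then p ^ Nat.card G.edgeSet * (1 - p) ^ (n.choose 2 - Nat.card G.edgeSet) else 0

/-- The property `Q` holds asymptotically almost surely in `G(n, p n)`. -/
def AAS (p : ℕ → ℝ) (Q : (n : ℕ) → SimpleGraph (Fin n) → Prop) : Prop :=
  Tendsto (fun n => gnpProb n (p n) (Q n)) atTop (nhds 1)

/-- `Γ` is `(p,ν)`-bijumbled. -/
def Bijumbled {n : ℕ} (Γ : SimpleGraph (Fin n)) (p ν : ℝ) : Prop :=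
  ∀ X Y : Finset (Fin n), Disjoint X Y →
    |(eXY Γ X Y : ℝ) - p * X.card * Y.card| ≤ ν * Real.sqrt ((X.card : ℝ) * Y.card)

/-- `(X,Y)` is an `(ε,d,p)`-lower-regular pair in `G`. -/
def LowerReg {n : ℕ} (G : SimpleGraph (Fin n)) (ε d p : ℝ) (X Y : Finset (Fin n)) : Prop :=
  ∀ X' ⊆ X, ∀ Y' ⊆ Y, ε * X.card ≤ X'.card → ε * Y.card ≤ Y'.card →
    d - ε ≤ (eXY G X' Y' : ℝ) / (p * X'.card * Y'.card)

/-- `(X,Y)` is an `(ε,d,p)`-regular pair in `G`. -/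
def Reg {n : ℕ} (G : SimpleGraph (Fin n)) (ε d p : ℝ) (X Y : Finset (Fin n)) : Prop :=
  ∃ d', d ≤ d' ∧ ∀ X' ⊆ X, ∀ Y' ⊆ Y, ε * X.card ≤ X'.card → ε * Y.card ≤ Y'.card →
    |(eXY G X' Y' : ℝ) / (p * X'.card * Y'.card) - d'| ≤ ε

/-- The degree conditions of `(ε,d,p)`-super-regularity of the pair `(X,Y)` for
`G ⊆ Γ`. -/
def SuperDeg {n : ℕ} (Γ G : SimpleGraph (Fin n)) (ε d p : ℝ) (X Y : Finset (Fin n)) : Prop :=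
  (∀ x ∈ X, (d - ε) * max (p * Y.card) (((nbhdIn Γ x Y).card : ℝ) / 2)
      ≤ ((nbhdIn G x Y).card : ℝ)) ∧
  (∀ y ∈ Y, (d - ε) * max (p * X.card) (((nbhdIn Γ y X).card : ℝ) / 2)
      ≤ ((nbhdIn G y X).card : ℝ))

/-- The backbone graph `B^k_r` on `[r] × [k]`: `(i,j)` and `(i',j')` are adjacent iff
`|i - i'| ≤ 1` and `j ≠ j'`. -/
def Bgraph (r k : ℕ) : SimpleGraph (Fin r × Fin k) :=
  SimpleGraph.fromRel fun a b =>
    ((a.1 : ℕ) ≤ (b.1 : ℕ) + 1 ∧ (b.1 : ℕ) ≤ (a.1 : ℕ) + 1) ∧ a.2 ≠ b.2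

/-- The clique factor `K^k_r` on `[r] × [k]`: `(i,j)` and `(i',j')` are adjacent iff
`i = i'` and `j ≠ j'`. -/
def Kgraph (r k : ℕ) : SimpleGraph (Fin r × Fin k) :=
  SimpleGraph.fromRel fun a b => a.1 = b.1 ∧ a.2 ≠ b.2

/-- `P` is a `k`-equitable partition of `U` indexed by `[r] × [k]`. -/
def IsEquitablePartitionOn {n r k : ℕ} (P : Fin r → Fin k → Finset (Fin n))
    (U : Finset (Fin n)) : Prop :=
  (∀ a b : Fin r × Fin k, a ≠ b → Disjoint (P a.1 a.2) (P b.1 b.2)) ∧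
  (Finset.univ.biUnion (fun a : Fin r × Fin k => P a.1 a.2) = U) ∧
  (∀ i : Fin r, ∀ j j' : Fin k, ((P i j).card : ℤ) - ((P i j').card : ℤ) ≤ 1)

/-- Block `t` (for `t ≥ 1`) of the labelling `L`, i.e. the vertices with labels in
`((t-1)·4kβn, t·4kβn]`, contains a vertex of colour zero. -/
def BlockHasZero {n k : ℕ} (β : ℝ) (L : Equiv.Perm (Fin n)) (σ : Fin n → Fin (k+1))
    (t : ℕ) : Prop :=
  ∃ v, σ v = 0 ∧ ((t : ℝ) - 1) * (4 * k * β * n) < ((L v : ℕ) : ℝ) + 1 ∧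
    ((L v : ℕ) : ℝ) + 1 ≤ (t : ℝ) * (4 * k * β * n)

/-- The colouring `σ` is `(z, β)`-zero-free with respect to the labelling `L`: any two
blocks containing colour zero are at least `z` apart. -/
def ZeroFree {n k : ℕ} (z β : ℝ) (L : Equiv.Perm (Fin n)) (σ : Fin n → Fin (k+1)) : Prop :=
  ∀ t₁ t₂ : ℕ, 1 ≤ t₁ → t₁ < t₂ → BlockHasZero β L σ t₁ → BlockHasZero β L σ t₂ →
    z ≤ (t₂ : ℝ) - (t₁ : ℝ)

end

/-- The conclusion of the Balancing lemma: a repartition `P'` of the same vertex set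
with exactly the prescribed part sizes, satisfying (B'1)–(B'5), where `pr` is the
relevant notion of a regular pair and `spr` the corresponding notion of a
super-regular pair. -/
def BalConc {n r k : ℕ} (Γ : SimpleGraph (Fin n)) (Δ r₁ : ℕ)
    (pr spr : Finset (Fin n) → Finset (Fin n) → Prop)
    (R : SimpleGraph (Fin r × Fin k))
    (P : Fin r → Fin k → Finset (Fin n)) (U : Finset (Fin n))
    (m : Fin r → Fin k → ℕ) (ε Cstar : ℝ) : Prop :=
  ∃ P' : Fin r → Fin k → Finset (Fin n),
    (∀ a b : Fin r × Fin k, a ≠ b → Disjoint (P' a.1 a.2) (P' b.1 b.2)) ∧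
    (Finset.univ.biUnion (fun a : Fin r × Fin k => P' a.1 a.2) = U) ∧
    -- (B'1)
    (∀ i j, (P' i j).card = m i j) ∧
    -- (B'2)
    (∀ i j, ((symmDiff (P i j) (P' i j)).card : ℝ)
        ≤ 1e-10 * ε ^ 4 * ((k : ℝ) ^ 2)⁻¹ * ((r₁ : ℝ) ^ 2)⁻¹ * n) ∧
    -- (B'3)
    (∀ a b : Fin r × Fin k, R.Adj a b → pr (P' a.1 a.2) (P' b.1 b.2)) ∧
    (∀ a b : Fin r × Fin k, (Kgraph r k).Adj a b → spr (P' a.1 a.2) (P' b.1 b.2)) ∧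
    -- (B'4)
    (∀ v ∈ U, ∀ i : Fin r, ∀ j j' : Fin k, j ≠ j' →
      pr (nbhdIn Γ v (P' i j)) (P' i j') ∧
      pr (nbhdIn Γ v (P' i j)) (nbhdIn Γ v (P' i j'))) ∧
    -- (B'5)
    (∀ s : ℕ, 1 ≤ s → s ≤ Δ → ∀ w : Fin s → Fin n, ∀ i j,
      ((symmDiff (commonNbhd Γ w Finset.univ (P i j))
          (commonNbhd Γ w Finset.univ (P' i j))).card : ℝ)
        ≤ 1e-10 * ε ^ 4 * ((k : ℝ) ^ 2)⁻¹ * ((r₁ : ℝ) ^ 2)⁻¹ *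
            ((commonNbhd Γ w Finset.univ Finset.univ).card : ℝ) + Cstar * Real.log n)

/-- Random-subset lemma, proved by an exponential-moment averaging argument. -/
theorem random_sub {n q : ℕ} (hq : 0 < q) {ι : Type*} [Fintype ι]
    (A : ι → Finset (Fin n)) (E : Finset (Fin n)) :
    ∃ T ⊆ E, E.card ≤ q * T.card ∧ ∀ i, ((A i ∩ T).card : ℝ) ≤
      2 / q * ((A i ∩ E).card : ℝ) + 2 * Real.log (q * Fintype.card ι) := by
  classical
  have hqR : (0 : ℝ) < q := by exact_mod_cast hq
  have : Nonempty (Fin q) := ⟨⟨0, hq⟩⟩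
  set x : ℝ := 1 + 1 / q with hx
  have hx0 : 0 < x := by positivity
  let B : ι → Finset (Fin n) := fun i => A i ∩ E
  have hcount : ∀ (i : ι) (c : Fin q),
      ∑ f : Fin n → Fin q, (2 : ℝ) ^ ((B i).filter (fun y => f y = c)).card
        = (q : ℝ) ^ n * x ^ (B i).card := by
    intro i c
    have h1 : ∀ f : Fin n → Fin q, (2 : ℝ) ^ ((B i).filter (fun y => f y = c)).card
        = ∏ y, (if y ∈ B i ∧ f y = c then (2 : ℝ) else 1) := by
      intro f
      rw [Finset.prod_ite]
      simp only [Finset.prod_const, one_pow, mul_one]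
      congr 2
      ext y; simp
    simp_rw [h1]
    have h2 := (Finset.prod_univ_sum (fun _ : Fin n => (Finset.univ : Finset (Fin q)))
      (fun y c' => if y ∈ B i ∧ c' = c then (2 : ℝ) else 1))
    rw [Fintype.piFinset_univ] at h2
    rw [← h2]
    have h3 : ∀ y : Fin n, ∑ c' : Fin q, (if y ∈ B i ∧ c' = c then (2 : ℝ) else 1)
        = q * (if y ∈ B i then x else 1) := by
      intro y
      by_cases hy : y ∈ B i
      · have : ∀ c' : Fin q, (if y ∈ B i ∧ c' = c then (2 : ℝ) else 1)
            = 1 + (if c' = c then 1 else 0) := by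
          intro c'; by_cases h : c' = c <;> simp [h, hy]; norm_num
        simp_rw [this, Finset.sum_add_distrib]
        simp [hy, hx]
        field_simp
      · simp [hy]
    simp_rw [h3]
    rw [Finset.prod_mul_distrib, Finset.prod_ite]
    simp
  have hex : ∃ f ∈ (Finset.univ : Finset (Fin n → Fin q)),
      (∑ i : ι, ∑ c : Fin q, (2 : ℝ) ^ ((B i).filter (fun y => f y = c)).card
        * (x ^ (B i).card)⁻¹) ≤ q * Fintype.card ι := by
    apply Finset.exists_le_of_sum_le Finset.univ_nonempty
    rw [Finset.sum_comm]
    have : ∀ i : ι, ∑ f : Fin n → Fin q, ∑ c : Fin q,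
        (2 : ℝ) ^ ((B i).filter (fun y => f y = c)).card * (x ^ (B i).card)⁻¹
        = q * q ^ n := by
      intro i
      rw [Finset.sum_comm]
      simp_rw [← Finset.sum_mul, hcount]
      have : x ^ (B i).card ≠ 0 := by positivity
      simp only [Finset.sum_const, Finset.card_univ, Fintype.card_fin, nsmul_eq_mul]
      field_simp
    simp_rw [this]
    simp
    apply le_of_eq; ring
  obtain ⟨f, -, hf⟩ := hex
  have hpig : ∃ c ∈ (Finset.univ : Finset (Fin q)), E.card ≤ q * (E.filter (fun y => f y = c)).card := by
    apply Finset.exists_le_of_sum_le Finset.univ_nonempty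
    rw [← Finset.mul_sum, ← Finset.card_eq_sum_card_fiberwise (fun y _ => by simp)]
    simp
  obtain ⟨c, -, hc⟩ := hpig
  refine ⟨E.filter (fun y => f y = c), Finset.filter_subset _ _, hc, ?_⟩
  intro i
  have hAT : A i ∩ E.filter (fun y => f y = c) = (B i).filter (fun y => f y = c) := by
    ext y; simp [B, and_assoc]
  rw [hAT]
  set m := ((B i).filter (fun y => f y = c)).card
  change (m : ℝ) ≤ 2 / q * ((B i).card : ℝ) + _
  have hterm : (2 : ℝ) ^ m * (x ^ (B i).card)⁻¹ ≤ q * Fintype.card ι := by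
    refine le_trans ?_ hf
    refine le_trans ?_ (Finset.single_le_sum (f := fun i => ∑ c : Fin q, (2 : ℝ) ^ ((B i).filter (fun y => f y = c)).card
        * (x ^ (B i).card)⁻¹) (fun i _ => Finset.sum_nonneg fun c _ => by positivity) (Finset.mem_univ i))
    exact Finset.single_le_sum (f := fun c => (2 : ℝ) ^ ((B i).filter (fun y => f y = c)).card
        * (x ^ (B i).card)⁻¹) (fun c _ => by positivity) (Finset.mem_univ c)
  have hpos : (0 : ℝ) < 2 ^ m * (x ^ (B i).card)⁻¹ := by positivity
  have hlog := Real.log_le_log hpos hterm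
  rw [Real.log_mul (by positivity) (by positivity), Real.log_inv, Real.log_pow, Real.log_pow] at hlog
  have hlx : Real.log x ≤ 1 / q := by
    have := Real.log_le_sub_one_of_pos hx0
    rw [hx] at this ⊢
    linarith
  have hl2 : (1 : ℝ) / 2 ≤ Real.log 2 := by have := Real.log_two_gt_d9; norm_num at *; linarith
  have h4 : ((B i).card : ℝ) * Real.log x ≤ (B i).card * (1 / q) := by gcongr
  have h5 : (m : ℝ) * (1 / 2) ≤ m * Real.log 2 := by gcongr
  have h6 : 2 / (q : ℝ) * (B i).card = 2 * ((B i).card * (1 / q)) := by ring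
  rw [h6]
  linarith

/-- Greedy choice of disjoint subsets of prescribed sizes. -/
theorem greedy_disjoint {α β : Type*} [DecidableEq α] [DecidableEq β] (J : Finset β) (S : β → Finset α) (t : β → ℕ)
    (h : ∀ b ∈ J, t b ≠ 0 → ∑ c ∈ J, t c ≤ (S b).card) :
    ∃ T : β → Finset α, (∀ b ∈ J, T b ⊆ S b ∧ (T b).card = t b) ∧
      (∀ b ∈ J, ∀ c ∈ J, b ≠ c → Disjoint (T b) (T c)) := by
  induction J using Finset.induction_on with
  | empty => exact ⟨fun _ => ∅, by simp, by simp⟩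
  | insert a J ha ih =>
    obtain ⟨T, hT, hD⟩ := ih (fun b hb hb0 => by
      have := h b (Finset.mem_insert_of_mem hb) hb0
      rw [Finset.sum_insert ha] at this; omega)
    have hcard : t a ≤ (S a \ J.biUnion T).card := by
      rcases Nat.eq_zero_or_pos (t a) with h0 | h0
      · omega
      have h1 := h a (Finset.mem_insert_self _ _) (by omega)
      rw [Finset.sum_insert ha] at h1
      have h2 : (J.biUnion T).card ≤ ∑ c ∈ J, t c :=
        Finset.card_biUnion_le.trans (Finset.sum_le_sum fun c hc => (hT c hc).2.le)
      have h3 := Finset.le_card_sdiff (J.biUnion T) (S a)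
      omega
    obtain ⟨W, hW, hWc⟩ := Finset.exists_subset_card_eq hcard
    have hWd : ∀ c ∈ J, Disjoint W (T c) := by
      intro c hc
      rw [Finset.disjoint_left]
      intro y hy hy'
      have := hW hy
      simp only [Finset.mem_sdiff, Finset.mem_biUnion, not_exists, not_and] at this
      exact this.2 c hc hy'
    refine ⟨Function.update T a W, ?_, ?_⟩
    · intro b hb
      by_cases hba : b = a
      · subst hba; simp; exact ⟨hW.trans Finset.sdiff_subset, hWc⟩
      · rw [Function.update_of_ne hba]
        exact hT b (Finset.mem_of_mem_insert_of_ne hb hba)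
    · intro b hb c hc hbc
      by_cases hba : b = a
      · subst hba
        rw [Function.update_self, Function.update_of_ne (Ne.symm hbc)]
        exact hWd c (Finset.mem_of_mem_insert_of_ne hc (Ne.symm hbc))
      · by_cases hca : c = a
        · subst hca
          rw [Function.update_self, Function.update_of_ne hba]
          exact (hWd b (Finset.mem_of_mem_insert_of_ne hb hba)).symm
        · rw [Function.update_of_ne hba, Function.update_of_ne hca]
          exact hD b (Finset.mem_of_mem_insert_of_ne hb hba) c (Finset.mem_of_mem_insert_of_ne hc hca) hbc

/-- There is a unit flow from `a` to `o` along `D`, with values at most `t`. -/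
def UFlow {I : Type*} [Fintype I] [DecidableEq I] (D : I → I → Prop) (t : ℕ) (a o : I) : Prop :=
  ∃ g : I → I → ℕ, (∀ x y, g x y ≠ 0 → D x y) ∧ (∀ x y, g x y ≤ t) ∧
    ∀ x, (∑ y, (g x y : ℤ)) - ∑ y, (g y x : ℤ) = (if x = a then 1 else 0) - (if x = o then 1 else 0)

theorem UFlow.refl {I : Type*} [Fintype I] [DecidableEq I] (D : I → I → Prop) (t : ℕ) (a : I) :
    UFlow D t a a := ⟨fun _ _ => 0, by simp, by simp, by simp⟩

theorem UFlow.mono {I : Type*} [Fintype I] [DecidableEq I] {D : I → I → Prop} {s t : ℕ} {a o : I}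
    (h : UFlow D s a o) (hst : s ≤ t) : UFlow D t a o := by
  obtain ⟨g, h1, h2, h3⟩ := h
  exact ⟨g, h1, fun x y => (h2 x y).trans hst, h3⟩

theorem UFlow.step {I : Type*} [Fintype I] [DecidableEq I] {D : I → I → Prop} {t : ℕ} {a b o : I}
    (hab : D a b) (h : UFlow D t b o) : UFlow D (t + 1) a o := by
  obtain ⟨g, h1, h2, h3⟩ := h
  refine ⟨fun x y => g x y + (if x = a ∧ y = b then 1 else 0), ?_, ?_, ?_⟩
  · intro x y hxy
    by_cases h : x = a ∧ y = b
    · rw [h.1, h.2]; exact hab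
    · simp [h] at hxy; exact h1 x y hxy
  · intro x y
    have := h2 x y
    dsimp only
    split_ifs <;> omega
  · intro x
    have h := h3 x
    have e1 : ∑ y, (((if x = a ∧ y = b then 1 else 0 : ℕ)) : ℤ) = if x = a then 1 else 0 := by
      by_cases hx : x = a <;> simp [hx]
    have e2 : ∑ y, (((if y = a ∧ x = b then 1 else 0 : ℕ)) : ℤ) = if x = b then 1 else 0 := by
      by_cases hx : x = b <;> simp [hx]
    simp only [Nat.cast_add, Finset.sum_add_distrib]
    rw [e1, e2]
    linarith

theorem exists_flow {I : Type*} [Fintype I] [DecidableEq I] {D : I → I → Prop} {t : ℕ} (o : I)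
    (hD : ∀ a b, UFlow D t a b) (b : I → ℤ) (hb : ∑ a, b a = 0) (M : ℝ) (hM : ∀ a, |(b a : ℝ)| ≤ M) :
    ∃ f : I → I → ℕ, (∀ x y, f x y ≠ 0 → D x y) ∧
      (∀ x y, (f x y : ℝ) ≤ Fintype.card I * (M * t)) ∧
      ∀ x, (∑ y, (f x y : ℤ)) - ∑ y, (f y x : ℤ) = b x := by
  choose g h1 h2 h3 using fun a => hD a o
  choose g' h1' h2' h3' using fun a => hD o a
  refine ⟨fun x y => ∑ a, ((b a).toNat * g a x y + (-b a).toNat * g' a x y), ?_, ?_, ?_⟩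
  · intro x y hxy
    obtain ⟨a, -, ha⟩ := Finset.exists_ne_zero_of_sum_ne_zero hxy
    by_cases hg : g a x y = 0
    · by_cases hg' : g' a x y = 0
      · simp [hg, hg'] at ha
      · exact h1' a x y hg'
    · exact h1 a x y hg
  · intro x y
    push_cast
    have : ∀ a ∈ (Finset.univ : Finset I), (((b a).toNat : ℝ) * g a x y + ((-b a).toNat : ℝ) * g' a x y) ≤ M * t := by
      intro a _
      have e : ((b a).toNat : ℝ) + ((-b a).toNat : ℝ) = |(b a : ℝ)| := by
        have : ((b a).toNat : ℤ) + ((-b a).toNat : ℤ) = |b a| := by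
          rcases abs_cases (b a) with ⟨h, h'⟩ | ⟨h, h'⟩ <;> omega
        exact_mod_cast this
      have i1 : (g a x y : ℝ) ≤ t := by exact_mod_cast h2 a x y
      have i2 : (g' a x y : ℝ) ≤ t := by exact_mod_cast h2' a x y
      calc _ ≤ ((b a).toNat : ℝ) * t + ((-b a).toNat : ℝ) * t := by gcongr
        _ = |(b a : ℝ)| * t := by rw [← e]; ring
        _ ≤ M * t := by gcongr; exact hM a
    calc _ ≤ ∑ a : I, M * t := Finset.sum_le_sum this
      _ = _ := by simp
  · intro x
    push_cast
    refine Eq.trans (congrArg₂ (· - ·) Finset.sum_comm Finset.sum_comm) ?_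
    rw [← Finset.sum_sub_distrib]
    have : ∀ a, (∑ y, ((((b a).toNat : ℤ)) * g a x y + (((-b a).toNat : ℤ)) * g' a x y)
        - ∑ y, ((((b a).toNat : ℤ)) * g a y x + (((-b a).toNat : ℤ)) * g' a y x))
        = b a * ((if x = a then 1 else 0) - (if x = o then 1 else 0)) := by
      intro a
      have k1 := h3 a x
      have k2 := h3' a x
      simp only [Finset.sum_add_distrib, ← Finset.mul_sum]
      have e : b a = ((b a).toNat : ℤ) - ((-b a).toNat : ℤ) := by omega
      generalize ((b a).toNat : ℤ) = u at *
      generalize ((-b a).toNat : ℤ) = v at *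
      rw [e]
      linear_combination u * k1 + v * k2
    have this' : ∀ a ∈ (Finset.univ : Finset I), _ := fun a _ => this a
    refine (Finset.sum_congr rfl this').trans ?_
    simp only [mul_sub, Finset.sum_sub_distrib, ← Finset.sum_mul, hb]
    simp

open Classical in
theorem eXY_eq_card {n : ℕ} (G : SimpleGraph (Fin n)) (X Y : Finset (Fin n)) :
    eXY G X Y = ((X ×ˢ Y).filter (fun q => G.Adj q.1 q.2)).card := by
  unfold eXY
  rw [Nat.card_eq_fintype_card, Fintype.card_subtype]
  congr 1
  ext q; simp [and_assoc]

theorem mem_nbhdIn {n : ℕ} {G : SimpleGraph (Fin n)} {v u : Fin n} {U : Finset (Fin n)} :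
    u ∈ nbhdIn G v U ↔ u ∈ U ∧ G.Adj v u := by
  unfold nbhdIn; simp

theorem mem_commonNbhd {n s : ℕ} {G : SimpleGraph (Fin n)} {w : Fin s → Fin n} {Λ : Finset (Fin s)}
    {u : Fin n} {U : Finset (Fin n)} :
    u ∈ commonNbhd G w Λ U ↔ u ∈ U ∧ ∀ j ∈ Λ, G.Adj (w j) u := by
  unfold commonNbhd; simp

theorem eXY_mono {n : ℕ} {G Γ : SimpleGraph (Fin n)} (hG : G ≤ Γ) {X X' Y Y' : Finset (Fin n)}
    (hX : X ⊆ X') (hY : Y ⊆ Y') : eXY G X Y ≤ eXY Γ X' Y' := by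
  classical
  rw [eXY_eq_card, eXY_eq_card]
  apply Finset.card_le_card
  intro q hq
  simp only [Finset.mem_filter, Finset.mem_product] at hq ⊢
  exact ⟨⟨hX hq.1.1, hY hq.1.2⟩, hG hq.2⟩

theorem eXY_split {n : ℕ} (G : SimpleGraph (Fin n)) (A B X Y : Finset (Fin n)) :
    eXY G A B ≤ eXY G (A ∩ X) (B ∩ Y) + eXY G (A \ X) B + eXY G A (B \ Y) := by
  classical
  rw [eXY_eq_card, eXY_eq_card, eXY_eq_card, eXY_eq_card]
  refine le_trans (Finset.card_le_card ?_) ((Finset.card_union_le _ _).trans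
    (Nat.add_le_add_right (Finset.card_union_le _ _) _))
  intro q hq
  simp only [Finset.mem_filter, Finset.mem_product, Finset.mem_union, Finset.mem_inter,
    Finset.mem_sdiff] at hq ⊢
  tauto

theorem eXY_eq_sum {n : ℕ} (G : SimpleGraph (Fin n)) (X Y : Finset (Fin n)) :
    eXY G X Y = ∑ x ∈ X, (nbhdIn G x Y).card := by
  classical
  rw [eXY_eq_card, Finset.card_filter, Finset.sum_product]
  refine Finset.sum_congr rfl fun x _ => ?_
  rw [← Finset.card_filter]
  rfl

theorem Reg.lower {n : ℕ} {G : SimpleGraph (Fin n)} {ε d p : ℝ} {X Y : Finset (Fin n)}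
    (h : Reg G ε d p X Y) : LowerReg G ε d p X Y := by
  obtain ⟨d', hd', h⟩ := h
  intro X' hX Y' hY h1 h2
  have := (abs_le.mp (h X' hX Y' hY h1 h2)).1
  linarith

theorem symmDiff_sub_card {α : Type*} [DecidableEq α] (X X' A : Finset α) (hA : A ⊆ X') :
    A.card ≤ (A ∩ X).card + (symmDiff X X').card := by
  have h : A \ X ⊆ symmDiff X X' := by
    intro y hy
    rw [Finset.mem_sdiff] at hy
    rw [Finset.mem_symmDiff]
    exact Or.inr ⟨hA hy.1, hy.2⟩
  have := Finset.card_le_card h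
  have := Finset.card_inter_add_card_sdiff A X
  omega

/-- size bookkeeping used by both transfer lemmas -/
theorem transfer_size {n : ℕ} {ε μ : ℝ} {X X' A : Finset (Fin n)} (hε0 : 0 < ε) (hε1 : ε ≤ 1 / 2)
    (hμ : μ ≤ ε / 100)
    (hX : ((symmDiff X X').card : ℝ) ≤ μ * X.card) (hA : A ⊆ X')
    (hAc : ε * X'.card ≤ A.card) :
    (X.card : ℝ) * ε ≤ 2 * A.card ∧ ε / 4 * X.card ≤ ((A ∩ X).card : ℝ) ∧
      (A.card : ℝ) * (1 - 2 * μ / ε) ≤ ((A ∩ X).card : ℝ) := by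
  have h1 : (A.card : ℝ) ≤ (A ∩ X).card + (symmDiff X X').card := by
    exact_mod_cast symmDiff_sub_card X X' A hA
  have h2 : (X.card : ℝ) ≤ X'.card + (symmDiff X X').card := by
    have := symmDiff_sub_card X' X X subset_rfl
    rw [symmDiff_comm] at this
    have h3 : (X ∩ X').card ≤ X'.card := Finset.card_le_card Finset.inter_subset_right
    exact_mod_cast this.trans (by omega)
  have hx : (0 : ℝ) ≤ X.card := by positivity
  have h4 : (X.card : ℝ) * ε ≤ 2 * A.card := by nlinarith
  have hsd0 : (0 : ℝ) ≤ (symmDiff X X').card := by positivity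
  refine ⟨h4, by nlinarith, ?_⟩
  rcases le_or_gt 0 μ with hm | hm
  · have h5 : μ * X.card ≤ A.card * (2 * μ / ε) := by
      have : (A.card : ℝ) * (2 * μ / ε) = μ * (2 * A.card / ε) := by ring
      rw [this]
      apply mul_le_mul_of_nonneg_left _ hm
      rw [le_div_iff₀ hε0]; exact h4
    linarith
  · have h0 : (X.card : ℝ) = 0 := by nlinarith
    have hX0 : X = ∅ := by simpa using h0
    have h6 : ((symmDiff X X').card : ℝ) = 0 := by rw [h0] at hX; linarith
    subst hX0
    have h7 : (A.card : ℝ) = 0 := by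
      simp at h1 h6
      have : A.card = 0 := by rw [h6] at hA; simpa using hA
      exact_mod_cast this
    rw [h7]; simp

theorem LowerReg.transfer {n : ℕ} {G : SimpleGraph (Fin n)} {ε d p μ : ℝ}
    {X Y X' Y' : Finset (Fin n)} (hp : 0 < p) (hε0 : 0 < ε) (hε1 : ε ≤ 1 / 2) (hεd : ε < d)
    (hμ0 : 0 ≤ μ) (hμ : μ ≤ ε ^ 2 / 100) (hμd : μ * d ≤ ε ^ 2 / 50)
    (hX0 : 0 < X.card) (hY0 : 0 < Y.card)
    (hX : ((symmDiff X X').card : ℝ) ≤ μ * X.card) (hY : ((symmDiff Y Y').card : ℝ) ≤ μ * Y.card)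
    (h : LowerReg G (ε / 4) d p X Y) : LowerReg G ε d p X' Y' := by
  intro A hA B hB hAc hBc
  have hμ' : μ ≤ ε / 100 := by nlinarith
  obtain ⟨a1, a2, a3⟩ := transfer_size hε0 hε1 hμ' hX hA hAc
  obtain ⟨b1, b2, b3⟩ := transfer_size hε0 hε1 hμ' hY hB hBc
  have hX0' : (0 : ℝ) < X.card := by exact_mod_cast hX0
  have hY0' : (0 : ℝ) < Y.card := by exact_mod_cast hY0
  have hApos : (0 : ℝ) < A.card := by nlinarith
  have hBpos : (0 : ℝ) < B.card := by nlinarith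
  have hA'pos : (0 : ℝ) < (A ∩ X).card := by nlinarith
  have hB'pos : (0 : ℝ) < (B ∩ Y).card := by nlinarith
  have h1 := h (A ∩ X) Finset.inter_subset_right (B ∩ Y) Finset.inter_subset_right a2 b2
  rw [le_div_iff₀ (by positivity)] at h1 ⊢
  have h2 : (eXY G (A ∩ X) (B ∩ Y) : ℝ) ≤ eXY G A B := by
    exact_mod_cast eXY_mono le_rfl Finset.inter_subset_left Finset.inter_subset_left
  set θ := 2 * μ / ε with hθ
  have hθ0 : 0 ≤ θ := by positivity
  have hθε : θ * ε = 2 * μ := by rw [hθ]; field_simp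
  have hθ1 : θ ≤ ε / 50 := by rw [hθ, div_le_iff₀ hε0]; nlinarith
  have hθd : θ * d ≤ ε / 25 := by
    have : θ * d = 2 * (μ * d) / ε := by rw [hθ]; ring
    rw [this, div_le_iff₀ hε0]; nlinarith
  have h3 : (A.card * (1 - θ)) * (B.card * (1 - θ)) ≤ ((A ∩ X).card : ℝ) * (B ∩ Y).card := by
    apply mul_le_mul a3 b3 _ hA'pos.le
    apply mul_nonneg hBpos.le; linarith
  have h4 : d - ε ≤ (d - ε / 4) * (1 - θ) ^ 2 := by
    have e1 : (d - ε / 4) * (1 - θ) ^ 2 = d - ε / 4 - 2 * (θ * d) + θ * ε / 2 + (d - ε / 4) * θ ^ 2 := by ring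
    have e2 : 0 ≤ (d - ε / 4) * θ ^ 2 := mul_nonneg (by linarith) (sq_nonneg θ)
    have e3 : 0 ≤ θ * ε := by positivity
    linarith
  have hpab : 0 < p * A.card * B.card := by positivity
  calc (d - ε) * (p * A.card * B.card) ≤ ((d - ε / 4) * (1 - θ) ^ 2) * (p * A.card * B.card) := by gcongr
    _ = ((d - ε / 4) * p) * ((A.card * (1 - θ)) * (B.card * (1 - θ))) := by ring
    _ ≤ ((d - ε / 4) * p) * (((A ∩ X).card : ℝ) * (B ∩ Y).card) := by
        apply mul_le_mul_of_nonneg_left h3; apply mul_nonneg _ hp.le; linarith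
    _ = (d - ε / 4) * (p * (A ∩ X).card * (B ∩ Y).card) := by ring
    _ ≤ _ := h1.trans h2

/-- bounding the number of edges touching a small set by enlarging it -/
theorem small_edges {n : ℕ} {Γ : SimpleGraph (Fin n)} {p τ μ : ℝ} (hp : 0 < p)
    (hΓ : ∀ A A' : Finset (Fin n), Disjoint A A' → τ ≤ (A.card : ℝ) → τ ≤ (A'.card : ℝ) →
      (eXY Γ A A' : ℝ) ≤ 2 * p * A.card * A'.card)
    {X X' Z B : Finset (Fin n)} (hμ : μ ≤ 1 / 4) (h1 : 1 ≤ μ * X.card) (hτ : τ ≤ μ * X.card)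
    (hX : ((symmDiff X X').card : ℝ) ≤ μ * X.card) (hZ : Z ⊆ X' \ X) (hB : Disjoint X' B)
    (hBτ : τ ≤ B.card) :
    (eXY Γ Z B : ℝ) ≤ 4 * μ * p * X.card * B.card := by
  have hZs : Z ⊆ symmDiff X X' := hZ.trans (by
    intro y hy; rw [Finset.mem_sdiff] at hy; rw [Finset.mem_symmDiff]; exact Or.inr hy)
  have hZc : (Z.card : ℝ) ≤ μ * X.card := le_trans (by exact_mod_cast Finset.card_le_card hZs) hX
  have h2 : (X.card : ℝ) ≤ X'.card + (symmDiff X X').card := by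
    have := symmDiff_sub_card X' X X subset_rfl
    rw [symmDiff_comm] at this
    have h3 : (X ∩ X').card ≤ X'.card := Finset.card_le_card Finset.inter_subset_right
    exact_mod_cast this.trans (by omega)
  have hx : (0 : ℝ) ≤ X.card := by positivity
  set N := ⌊2 * μ * (X.card : ℝ)⌋₊ with hN
  have hN1 : (N : ℝ) ≤ 2 * μ * X.card := Nat.floor_le (by nlinarith)
  have hN2 : 2 * μ * X.card < N + 1 := Nat.lt_floor_add_one _
  have hZN : Z.card ≤ N := by
    apply Nat.le_floor; linarith
  have hNX : N ≤ X'.card := by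
    have : (N : ℝ) ≤ X'.card := by nlinarith
    exact_mod_cast this
  obtain ⟨W, hW1, hW2, hW3⟩ := Finset.exists_subsuperset_card_eq (hZ.trans Finset.sdiff_subset) hZN hNX
  have h3 := hΓ W B (Finset.disjoint_of_subset_left hW2 hB) (by rw [hW3]; linarith) hBτ
  have h4 : (eXY Γ Z B : ℝ) ≤ eXY Γ W B := by exact_mod_cast eXY_mono le_rfl hW1 subset_rfl
  rw [hW3] at h3
  calc _ ≤ _ := h4
    _ ≤ _ := h3
    _ ≤ 2 * p * (2 * μ * X.card) * B.card := by gcongr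
    _ = _ := by ring

theorem eXY_comm {n : ℕ} (G : SimpleGraph (Fin n)) (X Y : Finset (Fin n)) :
    eXY G X Y = eXY G Y X := by
  unfold eXY
  apply Nat.card_congr
  exact ⟨fun q => ⟨q.1.swap, q.2.2.1, q.2.1, q.2.2.2.symm⟩,
    fun q => ⟨q.1.swap, q.2.2.1, q.2.1, q.2.2.2.symm⟩, fun _ => rfl, fun _ => rfl⟩

theorem transfer_key {ε μ u v : ℝ} (hε0 : 0 < ε) (hμ : μ ≤ ε ^ 2 / 200) (hu : 0 ≤ u)
    (huv : u * ε ≤ 2 * v) : 4 * μ * u ≤ ε / 20 * v := by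
  have h1 : 4 * μ * u ≤ 4 * (ε ^ 2 / 200) * u := by gcongr
  have h2 : 4 * (ε ^ 2 / 200) * u = ε / 50 * (u * ε) := by ring
  have h3 : ε / 50 * (u * ε) ≤ ε / 50 * (2 * v) := by gcongr
  have h4 : 0 ≤ ε * (2 * v) := mul_nonneg hε0.le (le_trans (by positivity) huv)
  linarith

set_option maxHeartbeats 1000000 in
theorem Reg.transfer {n : ℕ} {G Γ : SimpleGraph (Fin n)} (hG : G ≤ Γ) {ε d p μ τ : ℝ}
    {X Y X' Y' : Finset (Fin n)} (hp : 0 < p) (hε0 : 0 < ε) (hε1 : ε ≤ 1 / 2) (hεd : ε < d)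
    (hμ0 : 0 ≤ μ) (hμ : μ ≤ ε ^ 2 / 200)
    (hX1 : 1 ≤ μ * X.card) (hY1 : 1 ≤ μ * Y.card)
    (hXτ : τ ≤ μ * X.card) (hYτ : τ ≤ μ * Y.card)
    (hXY : Disjoint X Y) (hXY' : Disjoint X' Y')
    (hΓ : ∀ A A' : Finset (Fin n), Disjoint A A' → τ ≤ (A.card : ℝ) → τ ≤ (A'.card : ℝ) →
      (eXY Γ A A' : ℝ) ≤ 2 * p * A.card * A'.card)
    (hX : ((symmDiff X X').card : ℝ) ≤ μ * X.card) (hY : ((symmDiff Y Y').card : ℝ) ≤ μ * Y.card)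
    (h : Reg G (ε / 4) d p X Y) : Reg G ε d p X' Y' := by
  obtain ⟨d', hd', h⟩ := h
  have hX0' : (0 : ℝ) < X.card := by
    by_contra hc
    have : (X.card : ℝ) = 0 := le_antisymm (not_lt.mp hc) (by positivity)
    rw [this] at hX1; linarith
  have hY0' : (0 : ℝ) < Y.card := by
    by_contra hc
    have : (Y.card : ℝ) = 0 := le_antisymm (not_lt.mp hc) (by positivity)
    rw [this] at hY1; linarith
  have hμ1 : μ ≤ ε / 400 := by nlinarith
  have hdle : d' ≤ 3 := by
    have h1 := h X subset_rfl Y subset_rfl (by nlinarith) (by nlinarith)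
    have h2 := hΓ X Y hXY (by nlinarith) (by nlinarith)
    have h3 : (eXY G X Y : ℝ) ≤ eXY Γ X Y := by exact_mod_cast eXY_mono hG subset_rfl subset_rfl
    have h4 : (eXY G X Y : ℝ) / (p * X.card * Y.card) ≤ 2 := by
      rw [div_le_iff₀ (by positivity)]; linarith
    have := (abs_le.mp h1).1
    linarith
  have hlow : LowerReg G ε d' p X' Y' := by
    apply LowerReg.transfer hp hε0 hε1 (by linarith) hμ0 (by nlinarith) (by nlinarith)
      (by exact_mod_cast hX0') (by exact_mod_cast hY0') hX hY
    exact Reg.lower ⟨d', le_rfl, h⟩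
  refine ⟨d', hd', fun A hA B hB hAc hBc => ?_⟩
  obtain ⟨a1, a2, a3⟩ := transfer_size hε0 hε1 (by linarith) hX hA hAc
  obtain ⟨b1, b2, b3⟩ := transfer_size hε0 hε1 (by linarith) hY hB hBc
  have hApos : (0 : ℝ) < A.card := by nlinarith
  have hBpos : (0 : ℝ) < B.card := by nlinarith
  have hA'pos : (0 : ℝ) < (A ∩ X).card := by nlinarith
  have hB'pos : (0 : ℝ) < (B ∩ Y).card := by nlinarith
  rw [abs_le]
  refine ⟨by have := hlow A hA B hB hAc hBc; linarith, ?_⟩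
  have h1 := (abs_le.mp (h (A ∩ X) Finset.inter_subset_right (B ∩ Y) Finset.inter_subset_right a2 b2)).2
  have h1' : (eXY G (A ∩ X) (B ∩ Y) : ℝ) / (p * (A ∩ X).card * (B ∩ Y).card) ≤ d' + ε / 4 := by linarith
  rw [div_le_iff₀ (by positivity)] at h1'
  have h2 : (eXY G (A ∩ X) (B ∩ Y) : ℝ) ≤ (d' + ε / 4) * (p * A.card * B.card) := by
    refine h1'.trans ?_
    have i1 : ((A ∩ X).card : ℝ) ≤ A.card := by exact_mod_cast Finset.card_le_card Finset.inter_subset_left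
    have i2 : ((B ∩ Y).card : ℝ) ≤ B.card := by exact_mod_cast Finset.card_le_card Finset.inter_subset_left
    have : 0 ≤ d' + ε / 4 := by linarith
    gcongr
  have hμX : μ * X.card ≤ A.card := by
    have : μ * X.card ≤ ε / 400 * X.card := by gcongr
    linarith
  have hμY : μ * Y.card ≤ B.card := by
    have : μ * Y.card ≤ ε / 400 * Y.card := by gcongr
    linarith
  have h3 : (eXY G (A \ X) B : ℝ) ≤ 4 * μ * p * X.card * B.card := by
    refine le_trans (by exact_mod_cast eXY_mono hG subset_rfl subset_rfl) (small_edges hp hΓ (by linarith) hX1 hXτ hX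
      (Finset.sdiff_subset_sdiff hA subset_rfl) (Finset.disjoint_of_subset_right hB hXY') (by linarith))
  have h4 : (eXY G A (B \ Y) : ℝ) ≤ 4 * μ * p * Y.card * A.card := by
    rw [eXY_comm]
    refine le_trans (by exact_mod_cast eXY_mono hG subset_rfl subset_rfl) (small_edges hp hΓ (by linarith) hY1 hYτ hY
      (Finset.sdiff_subset_sdiff hB subset_rfl) (Finset.disjoint_of_subset_right hA hXY'.symm) (by linarith))
  have h5 : (eXY G A B : ℝ) ≤ eXY G (A ∩ X) (B ∩ Y) + eXY G (A \ X) B + eXY G A (B \ Y) := by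
    exact_mod_cast eXY_split G A B X Y
  have h6 := transfer_key hε0 hμ hX0'.le a1
  have h7 := transfer_key hε0 hμ hY0'.le b1
  have h6' : 4 * μ * p * X.card * B.card ≤ ε / 20 * (p * A.card * B.card) := by
    have : 4 * μ * p * X.card * B.card = (4 * μ * X.card) * (p * B.card) := by ring
    rw [this]
    calc _ ≤ (ε / 20 * A.card) * (p * B.card) := by gcongr
      _ = _ := by ring
  have h7' : 4 * μ * p * Y.card * A.card ≤ ε / 20 * (p * A.card * B.card) := by
    have : 4 * μ * p * Y.card * A.card = (4 * μ * Y.card) * (p * A.card) := by ring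
    rw [this]
    calc _ ≤ (ε / 20 * B.card) * (p * A.card) := by gcongr
      _ = _ := by ring
  have h8 : (eXY G A B : ℝ) / (p * A.card * B.card) ≤ d' + ε := by
    rw [div_le_iff₀ (by positivity)]
    have : 0 < p * A.card * B.card := by positivity
    nlinarith
  linarith

theorem repartition {n : ℕ} {I : Type*} [Fintype I] [DecidableEq I] (V : I → Finset (Fin n))
    (hdis : ∀ a b, a ≠ b → Disjoint (V a) (V b)) (f : I → I → ℕ) (S : I → I → Finset (Fin n))
    (hS : ∀ a b, S a b ⊆ V a) (hf : ∀ a b, f a b ≠ 0 → ∑ c, f a c ≤ (S a b).card) :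
    ∃ (V' : I → Finset (Fin n)) (T : I → I → Finset (Fin n)),
      (∀ a b, T a b ⊆ S a b) ∧ (∀ a b, (T a b).card = f a b) ∧
      (∀ a b, a ≠ b → Disjoint (V' a) (V' b)) ∧
      (Finset.univ.biUnion V' = Finset.univ.biUnion V) ∧
      (∀ a, (V' a).card + ∑ b, f a b = (V a).card + ∑ b, f b a) ∧
      (∀ a, symmDiff (V a) (V' a) ⊆ Finset.univ.biUnion (T a) ∪ Finset.univ.biUnion (fun b => T b a)) ∧
      (∀ a, ∀ x ∈ V' a, x ∈ V a ∨ ∃ b, f b a ≠ 0 ∧ x ∈ S b a) := by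
  have := fun a => greedy_disjoint Finset.univ (S a) (f a) (fun b _ hb => hf a b hb)
  choose T hT hTd using this
  have hTS : ∀ a b, T a b ⊆ S a b := fun a b => (hT a b (Finset.mem_univ _)).1
  have hTc : ∀ a b, (T a b).card = f a b := fun a b => (hT a b (Finset.mem_univ _)).2
  have hTV : ∀ a b x, x ∈ T a b → x ∈ V a := fun a b x hx => hS a b (hTS a b hx)
  have hVu : ∀ a b x, x ∈ V a → x ∈ V b → a = b := by
    intro a b x h1 h2
    by_contra hne
    exact Finset.disjoint_left.mp (hdis a b hne) h1 h2
  have hTu : ∀ a b c x, x ∈ T a b → x ∈ T a c → b = c := by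
    intro a b c x h1 h2
    by_contra hne
    exact Finset.disjoint_left.mp (hTd a b (Finset.mem_univ _) c (Finset.mem_univ _) hne) h1 h2
  refine ⟨fun a => (V a \ Finset.univ.biUnion (T a)) ∪ Finset.univ.biUnion (fun b => T b a), T, hTS, hTc, ?_, ?_, ?_, ?_, ?_⟩
  · intro a b hab
    rw [Finset.disjoint_left]
    intro x hx hx'
    simp only [Finset.mem_union, Finset.mem_sdiff, Finset.mem_biUnion, Finset.mem_univ, true_and, not_exists] at hx hx'
    rcases hx with ⟨h1, h2⟩ | ⟨c, h1⟩ <;> rcases hx' with ⟨h3, h4⟩ | ⟨c', h3⟩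
    · exact hab (hVu a b x h1 h3)
    · have := hVu a c' x h1 (hTV _ _ _ h3); subst this; exact h2 _ h3
    · have := hVu b c x h3 (hTV _ _ _ h1); subst this; exact h4 _ h1
    · have := hVu c c' x (hTV _ _ _ h1) (hTV _ _ _ h3); subst this; exact hab (hTu _ _ _ _ h1 h3)
  · ext x
    simp only [Finset.mem_union, Finset.mem_sdiff, Finset.mem_biUnion, Finset.mem_univ, true_and, not_exists]
    constructor
    · rintro ⟨a, ⟨h, -⟩ | ⟨c, h⟩⟩
      · exact ⟨a, h⟩
      · exact ⟨c, hTV _ _ _ h⟩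
    · rintro ⟨a, h⟩
      by_cases hc : ∃ c, x ∈ T a c
      · obtain ⟨c, hc⟩ := hc
        exact ⟨c, Or.inr ⟨a, hc⟩⟩
      · exact ⟨a, Or.inl ⟨h, fun c h' => hc ⟨c, h'⟩⟩⟩
  · intro a
    have c1 : (Finset.univ.biUnion (T a)).card = ∑ b, f a b := by
      rw [Finset.card_biUnion (fun b hb c hc hbc => hTd a b hb c hc hbc)]
      exact Finset.sum_congr rfl fun b _ => hTc a b
    have c2 : (Finset.univ.biUnion (fun b => T b a)).card = ∑ b, f b a := by
      rw [Finset.card_biUnion]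
      · exact Finset.sum_congr rfl fun b _ => hTc b a
      · intro b _ c _ hbc
        exact Finset.disjoint_of_subset_left ((hTS b a).trans (hS b a))
          (Finset.disjoint_of_subset_right ((hTS c a).trans (hS c a)) (hdis b c hbc))
    have c3 : Finset.univ.biUnion (T a) ⊆ V a := by
      intro x hx
      simp only [Finset.mem_biUnion, Finset.mem_univ, true_and] at hx
      obtain ⟨b, hb⟩ := hx
      exact hTV _ _ _ hb
    have c4 : Disjoint (V a \ Finset.univ.biUnion (T a)) (Finset.univ.biUnion (fun b => T b a)) := by
      rw [Finset.disjoint_left]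
      intro x h1 h2
      simp only [Finset.mem_sdiff, Finset.mem_biUnion, Finset.mem_univ, true_and, not_exists] at h1 h2
      obtain ⟨b, hb⟩ := h2
      have := hVu a b x h1.1 (hTV _ _ _ hb)
      subst this
      exact h1.2 _ hb
    have c5 := Finset.card_sdiff_add_card_eq_card c3
    dsimp only
    rw [Finset.card_union_of_disjoint c4, c2]
    omega
  · intro a x hx
    rw [Finset.mem_symmDiff] at hx
    simp only [Finset.mem_union, Finset.mem_sdiff, Finset.mem_biUnion, Finset.mem_univ, true_and, not_exists, not_or, not_and] at hx ⊢
    rcases hx with ⟨h1, h2, h3⟩ | ⟨h1, h2⟩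
    · left
      by_contra hc
      exact h2 h1 (fun c h => hc ⟨c, h⟩)
    · rcases h1 with h | h
      · exact absurd h.1 h2
      · exact Or.inr h
  · intro a x hx
    simp only [Finset.mem_union, Finset.mem_sdiff, Finset.mem_biUnion, Finset.mem_univ, true_and, not_exists] at hx
    rcases hx with h | ⟨b, h⟩
    · exact Or.inl h.1
    · refine Or.inr ⟨b, ?_, hTS _ _ h⟩
      rw [← hTc b a]
      exact Finset.card_ne_zero_of_mem h

theorem Kgraph_adj {r k : ℕ} {a b : Fin r × Fin k} : (Kgraph r k).Adj a b ↔ a.1 = b.1 ∧ a.2 ≠ b.2 := by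
  unfold Kgraph
  rw [SimpleGraph.fromRel_adj]
  constructor
  · rintro ⟨-, h | h⟩
    · exact h
    · exact ⟨h.1.symm, h.2.symm⟩
  · intro h
    exact ⟨fun hab => h.2 (by rw [hab]), Or.inl h⟩

theorem conn {r k : ℕ} {R : SimpleGraph (Fin r × Fin k)} (hB : Bgraph r k ≤ R)
    (hdeg : ∀ a, k * r < degV R a + r) (a b : Fin r × Fin k) :
    UFlow (fun a b => ∀ c, (Kgraph r k).Adj b c → R.Adj a c) (r + 1) a b := by
  classical
  set D : Fin r × Fin k → Fin r × Fin k → Prop := fun a b => ∀ c, (Kgraph r k).Adj b c → R.Adj a c with hD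
  have s1 : ∀ (i i' : Fin r) (j : Fin k), (i : ℕ) ≤ i' + 1 → (i' : ℕ) ≤ i + 1 → D (i, j) (i', j) := by
    intro i i' j h1 h2 c hc
    rw [Kgraph_adj] at hc
    apply hB
    unfold Bgraph
    rw [SimpleGraph.fromRel_adj]
    have e : c.1 = i' := hc.1.symm
    have e2 : j ≠ c.2 := hc.2
    refine ⟨fun h => e2 (by rw [← h]), Or.inl ⟨⟨by simpa [e] using h1, by simpa [e] using h2⟩, e2⟩⟩
  have s2 : ∃ i' : Fin r, ∀ j, R.Adj a (i', j) := by
    by_contra hcon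
    push Not at hcon
    choose g hg using hcon
    have h := hdeg a
    have h1 : degV R a = (R.neighborFinset a).card := by
      unfold degV
      rw [Nat.card_eq_fintype_card, SimpleGraph.card_neighborSet_eq_degree]; rfl
    have h2 : Disjoint (R.neighborFinset a) (Finset.univ.image (fun i : Fin r => (i, g i))) := by
      rw [Finset.disjoint_left]
      intro x hx hx'
      simp only [Finset.mem_image, Finset.mem_univ, true_and] at hx'
      obtain ⟨i, rfl⟩ := hx'
      rw [SimpleGraph.mem_neighborFinset] at hx
      exact hg i hx
    have h3 : (Finset.univ.image (fun i : Fin r => (i, g i))).card = r := by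
      rw [Finset.card_image_of_injective _ (fun i i' h => by simpa using congrArg Prod.fst h)]
      simp
    have h4 := Finset.card_le_univ (R.neighborFinset a ∪ Finset.univ.image (fun i : Fin r => (i, g i)))
    rw [Finset.card_union_of_disjoint h2, h3, Fintype.card_prod, Fintype.card_fin, Fintype.card_fin, mul_comm] at h4
    omega
  have s3 : ∀ (t : ℕ) (i i' : Fin r) (j : Fin k), (i : ℕ) ≤ i' + t → (i' : ℕ) ≤ i + t → UFlow D t (i, j) (i', j) := by
    intro t
    induction t with
    | zero =>
      intro i i' j h1 h2
      have : i = i' := Fin.ext (by omega)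
      subst this
      exact UFlow.refl _ _ _
    | succ t ih =>
      intro i i' j h1 h2
      rcases lt_trichotomy (i : ℕ) i' with h | h | h
      · have hlt : (i : ℕ) + 1 < r := lt_of_le_of_lt h i'.2
        refine UFlow.step (s1 i ⟨i + 1, hlt⟩ j (by simp; omega) (by simp)) (ih _ _ _ ?_ ?_)
        · simp; omega
        · simp; omega
      · have : i = i' := Fin.ext h
        subst this
        exact UFlow.refl _ _ _
      · have hlt : (i : ℕ) - 1 < r := by have := i.2; omega
        refine UFlow.step (s1 i ⟨i - 1, hlt⟩ j (by simp; omega) (by simp; omega)) (ih _ _ _ ?_ ?_)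
        · simp; omega
        · simp; omega
  obtain ⟨i', hi'⟩ := s2
  refine UFlow.step (b := (i', b.2)) ?_ (s3 r i' b.1 b.2 ?_ ?_)
  · intro c hc
    rw [Kgraph_adj] at hc
    have : c = (i', c.2) := Prod.ext hc.1.symm rfl
    rw [this]; exact hi' _
  · have := i'.2; omega
  · have := b.1.2; omega

open Classical in
theorem bad_card {n : ℕ} {G : SimpleGraph (Fin n)} {ε d p : ℝ} {X Y : Finset (Fin n)} (hp : 0 < p)
    (hε0 : 0 < ε) (hε1 : ε ≤ 1) (hX : 0 < X.card) (hY : 0 < Y.card) (h : LowerReg G ε d p X Y) :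
    ((X.filter (fun x => ((nbhdIn G x Y).card : ℝ) < (d - ε) * (p * Y.card))).card : ℝ) ≤ ε * X.card := by
  by_contra hcon
  rw [not_le] at hcon
  set Z := X.filter (fun x => ((nbhdIn G x Y).card : ℝ) < (d - ε) * (p * Y.card)) with hZ
  have hX' : (0 : ℝ) < X.card := by exact_mod_cast hX
  have hY' : (0 : ℝ) < Y.card := by exact_mod_cast hY
  have hZ0 : (0 : ℝ) < Z.card := lt_trans (by positivity) hcon
  have h1 := h Z (Finset.filter_subset _ _) Y subset_rfl hcon.le (by nlinarith)
  rw [le_div_iff₀ (by positivity), eXY_eq_sum] at h1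
  push_cast at h1
  have h2 : ∑ x ∈ Z, ((nbhdIn G x Y).card : ℝ) < ∑ x ∈ Z, (d - ε) * (p * Y.card) := by
    apply Finset.sum_lt_sum_of_nonempty
    · rw [← Finset.card_pos]; exact_mod_cast hZ0
    · intro x hx; exact (Finset.mem_filter.mp hx).2
  rw [Finset.sum_const, nsmul_eq_mul] at h2
  linarith

open Classical in
theorem eligible {n r k : ℕ} {G : SimpleGraph (Fin n)} {ε d p : ℝ} {X : Finset (Fin n)}
    {V : Fin r × Fin k → Finset (Fin n)} (hp : 0 < p)
    (hε0 : 0 < ε) (hε1 : k * ε ≤ 1 / 2) (hε2 : ε ≤ 1) (hX : 0 < X.card) (hV : ∀ a, 0 < (V a).card) (b : Fin r × Fin k)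
    (h : ∀ c, (Kgraph r k).Adj b c → LowerReg G (ε / 4) d p X (V c)) :
    X.card ≤ 2 * (X.filter (fun x => ∀ c, (Kgraph r k).Adj b c →
      (d - ε / 4) * (p * (V c).card) ≤ ((nbhdIn G x (V c)).card : ℝ))).card := by
  set E := X.filter (fun x => ∀ c, (Kgraph r k).Adj b c →
      (d - ε / 4) * (p * (V c).card) ≤ ((nbhdIn G x (V c)).card : ℝ)) with hE
  have hsub : X ⊆ E ∪ (Finset.univ.filter (fun j : Fin k => b.2 ≠ j)).biUnion (fun j =>
      X.filter (fun x => ((nbhdIn G x (V (b.1, j))).card : ℝ) < (d - ε / 4) * (p * (V (b.1, j)).card))) := by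
    intro x hx
    rw [Finset.mem_union]
    by_cases hxE : x ∈ E
    · exact Or.inl hxE
    · right
      have : ¬ ∀ c, (Kgraph r k).Adj b c →
        (d - ε / 4) * (p * (V c).card) ≤ ((nbhdIn G x (V c)).card : ℝ) := by
        intro hh; exact hxE (Finset.mem_filter.mpr ⟨hx, hh⟩)
      push Not at this
      obtain ⟨c, hc, hlt⟩ := this
      rw [Kgraph_adj] at hc
      have e : c = (b.1, c.2) := Prod.ext hc.1.symm rfl
      rw [e] at hlt
      simp only [Finset.mem_biUnion, Finset.mem_filter, Finset.mem_univ, true_and]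
      exact ⟨c.2, hc.2, hx, hlt⟩
  have h1 := (Finset.card_le_card hsub).trans ((Finset.card_union_le _ _).trans
    (Nat.add_le_add_left Finset.card_biUnion_le _))
  have h1' : (X.card : ℝ) ≤ E.card + ∑ j ∈ Finset.univ.filter (fun j : Fin k => b.2 ≠ j),
      ((X.filter (fun x => ((nbhdIn G x (V (b.1, j))).card : ℝ) < (d - ε / 4) * (p * (V (b.1, j)).card))).card : ℝ) := by
    exact_mod_cast h1
  have h2 : ∑ j ∈ Finset.univ.filter (fun j : Fin k => b.2 ≠ j),
      ((X.filter (fun x => ((nbhdIn G x (V (b.1, j))).card : ℝ) < (d - ε / 4) * (p * (V (b.1, j)).card))).card : ℝ)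
      ≤ ∑ j ∈ Finset.univ.filter (fun j : Fin k => b.2 ≠ j), ε / 4 * X.card := by
    apply Finset.sum_le_sum
    intro j hj
    apply bad_card hp (by positivity) (by linarith) hX (hV _) (h _ _)
    rw [Kgraph_adj]
    exact ⟨rfl, (Finset.mem_filter.mp hj).2⟩
  rw [Finset.sum_const, nsmul_eq_mul] at h2
  have h3 : ((Finset.univ.filter (fun j : Fin k => b.2 ≠ j)).card : ℝ) ≤ k := by
    have := Finset.card_le_univ (Finset.univ.filter (fun j : Fin k => b.2 ≠ j))
    rw [Fintype.card_fin] at this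
    exact_mod_cast this
  have h4 : ((Finset.univ.filter (fun j : Fin k => b.2 ≠ j)).card : ℝ) * (ε / 4 * X.card) ≤ k * (ε / 4 * X.card) := by gcongr
  have h5 : k * (ε / 4 * X.card) = (k * ε) * (X.card / 4 : ℝ) := by ring
  have h6 : (k * ε) * (X.card / 4 : ℝ) ≤ 1 / 2 * (X.card / 4 : ℝ) := by gcongr
  have hX' : (0 : ℝ) < X.card := by exact_mod_cast hX
  have : (X.card : ℝ) ≤ 2 * E.card := by linarith
  exact_mod_cast this

theorem nbhdIn_symmDiff {n : ℕ} (G : SimpleGraph (Fin n)) (v : Fin n) (X Y : Finset (Fin n)) :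
    nbhdIn G v (symmDiff X Y) = symmDiff (nbhdIn G v X) (nbhdIn G v Y) := by
  ext y; simp only [mem_nbhdIn, Finset.mem_symmDiff]; tauto

theorem commonNbhd_symmDiff {n s : ℕ} (G : SimpleGraph (Fin n)) (w : Fin s → Fin n) (Λ : Finset (Fin s))
    (X Y : Finset (Fin n)) :
    commonNbhd G w Λ (symmDiff X Y) = symmDiff (commonNbhd G w Λ X) (commonNbhd G w Λ Y) := by
  ext y; simp only [mem_commonNbhd, Finset.mem_symmDiff]; tauto

theorem card_le_symmDiff {α : Type*} [DecidableEq α] (X X' : Finset α) :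
    (X'.card : ℝ) ≤ X.card + (symmDiff X X').card := by
  have h := symmDiff_sub_card X X' X' subset_rfl
  have h3 : (X' ∩ X).card ≤ X.card := Finset.card_le_card Finset.inter_subset_right
  exact_mod_cast h.trans (by omega)

theorem superdeg_transfer {n : ℕ} {G Γ : SimpleGraph (Fin n)} (hG : G ≤ Γ) {ε d p μ : ℝ} {x : Fin n}
    {Y Y' : Finset (Fin n)} (hp : 0 < p) (hε0 : 0 < ε) (hε1 : ε ≤ 1 / 2) (hεd : ε < d)
    (hμ0 : 0 ≤ μ) (hμ : μ * (1 + d) ≤ ε / 2)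
    (h1 : (d - ε / 4) * (p * Y.card) ≤ ((nbhdIn G x Y).card : ℝ))
    (h2 : ((nbhdIn Γ x Y).card : ℝ) ≤ (1 + ε / 4) * (p * Y.card))
    (h3 : ((nbhdIn Γ x (symmDiff Y Y')).card : ℝ) ≤ μ * (p * Y.card))
    (h4 : ((symmDiff Y Y').card : ℝ) ≤ μ * Y.card) :
    (d - ε) * max (p * Y'.card) (((nbhdIn Γ x Y').card : ℝ) / 2) ≤ ((nbhdIn G x Y').card : ℝ) := by
  have a1 := card_le_symmDiff (nbhdIn G x Y') (nbhdIn G x Y)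
  have a2 := card_le_symmDiff (nbhdIn Γ x Y) (nbhdIn Γ x Y')
  have a3 := card_le_symmDiff Y Y'
  rw [symmDiff_comm, ← nbhdIn_symmDiff] at a1
  rw [← nbhdIn_symmDiff] at a2
  have a4 : ((nbhdIn G x (symmDiff Y Y')).card : ℝ) ≤ (nbhdIn Γ x (symmDiff Y Y')).card := by
    have : nbhdIn G x (symmDiff Y Y') ⊆ nbhdIn Γ x (symmDiff Y Y') := by
      intro y hy
      rw [mem_nbhdIn] at hy ⊢
      exact ⟨hy.1, hG hy.2⟩
    exact_mod_cast Finset.card_le_card this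
  have hy : (0 : ℝ) ≤ p * Y.card := by positivity
  have hμ1 : μ ≤ ε / 2 := by nlinarith
  have a5 : max (p * Y'.card) (((nbhdIn Γ x Y').card : ℝ) / 2) ≤ (1 + μ) * (p * Y.card) := by
    apply max_le
    · calc p * (Y'.card : ℝ) ≤ p * (Y.card + μ * Y.card) := by gcongr; linarith
        _ = _ := by ring
    · have : (1 + ε / 4) * (p * Y.card) + μ * (p * Y.card) ≤ 2 * ((1 + μ) * (p * Y.card)) := by nlinarith
      linarith
  have a6 : (d - ε) * max (p * Y'.card) (((nbhdIn Γ x Y').card : ℝ) / 2) ≤ (d - ε) * ((1 + μ) * (p * Y.card)) := by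
    apply mul_le_mul_of_nonneg_left a5; linarith
  have a7 : (d - ε) * (1 + μ) ≤ d - ε / 4 - μ := by nlinarith
  have a8 := mul_le_mul_of_nonneg_right a7 hy
  nlinarith

open Classical in
theorem balance_core {n r k r₁ Δ q : ℕ} {Γ G : SimpleGraph (Fin n)} {ε d p ξ : ℝ} (hq : 0 < q) (hk : 1 ≤ k)
    (hr : r ≤ r₁) (hr0 : 0 < r) (hn : 0 < n) (hp : 0 < p) (hξ0 : 0 < ξ)
    (hε0 : 0 < ε) (hε1 : k * ε ≤ 1 / 2) (hε2 : ε ≤ 1)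
    (hξ : 16 * ((k : ℝ) * r₁) * q * (((k : ℝ) * r₁) ^ 2 * (r₁ + 1)) * ξ ≤ 1)
    (V : Fin r × Fin k → Finset (Fin n)) (hdis : ∀ a b, a ≠ b → Disjoint (V a) (V b))
    (hVlow : ∀ a, (n : ℝ) / (8 * (k * r₁)) ≤ (V a).card)
    (m : Fin r × Fin k → ℕ) (hm : ∑ a, m a = ∑ a, (V a).card)
    (hB1 : ∀ a, |((V a).card : ℝ) - m a| ≤ ξ * n)
    {R : SimpleGraph (Fin r × Fin k)} (hB : Bgraph r k ≤ R) (hdeg : ∀ a, k * r < degV R a + r)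
    (hR : ∀ a b, R.Adj a b → LowerReg G (ε / 4) d p (V a) (V b))
    (hK : ∀ a c, (Kgraph r k).Adj a c → ∀ x ∈ V a, (d - ε / 4) * (p * (V c).card) ≤ ((nbhdIn G x (V c)).card : ℝ)) :
    ∃ V' : Fin r × Fin k → Finset (Fin n),
      (∀ a b, a ≠ b → Disjoint (V' a) (V' b)) ∧
      (Finset.univ.biUnion V' = Finset.univ.biUnion V) ∧
      (∀ a, (V' a).card = m a) ∧
      (∀ a, ((symmDiff (V a) (V' a)).card : ℝ) ≤ 2 * (((k : ℝ) * r₁) ^ 2 * (r₁ + 1)) * ξ * n) ∧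
      (∀ a c, (Kgraph r k).Adj a c → ∀ x ∈ V' a, (d - ε / 4) * (p * (V c).card) ≤ ((nbhdIn G x (V c)).card : ℝ)) ∧
      (∀ (w : Fin Δ → Fin n) (a) (X : ℝ), (∀ b, ((commonNbhd Γ w Finset.univ (V b)).card : ℝ) ≤ X) →
        ((commonNbhd Γ w Finset.univ (symmDiff (V a) (V' a))).card : ℝ) ≤
          2 * ((k : ℝ) * r₁) * (2 / q * X + 2 * Real.log (q * n ^ Δ))) := by
  have hkR : (1 : ℝ) ≤ k := by exact_mod_cast hk
  have hrR : (r : ℝ) ≤ r₁ := by exact_mod_cast hr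
  have hr1R : (1 : ℝ) ≤ r₁ := by exact_mod_cast (by omega : 1 ≤ r₁)
  have hnR : (0 : ℝ) < n := by exact_mod_cast hn
  have hqR : (1 : ℝ) ≤ q := by exact_mod_cast hq
  set K : ℝ := (k : ℝ) * r₁ with hKdef
  have hK1 : 1 ≤ K := by nlinarith
  have hcI : (Fintype.card (Fin r × Fin k) : ℝ) ≤ K := by
    rw [Fintype.card_prod, Fintype.card_fin, Fintype.card_fin, hKdef]
    push_cast
    nlinarith
  have hVpos : ∀ a, 0 < (V a).card := by
    intro a
    have : (0 : ℝ) < (V a).card := lt_of_lt_of_le (by positivity) (hVlow a)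
    exact_mod_cast this
  obtain ⟨f, hfD, hfb, hfd⟩ := exists_flow (t := r + 1) ((⟨0, hr0⟩, ⟨0, hk⟩) : Fin r × Fin k) (conn hB hdeg)
    (fun a => ((V a).card : ℤ) - m a)
    (by rw [Finset.sum_sub_distrib]; have : (∑ a, (m a : ℤ)) = ∑ a, ((V a).card : ℤ) := by exact_mod_cast hm
        linarith)
    (ξ * n) (by intro a; push_cast; exact hB1 a)
  set F : ℝ := K * (ξ * n * (r₁ + 1)) with hF
  have hF0 : 0 ≤ F := by positivity
  have hfF : ∀ x y, (f x y : ℝ) ≤ F := by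
    intro x y
    refine (hfb x y).trans ?_
    rw [hF]; push_cast
    gcongr
  have hsumle : ∀ g : Fin r × Fin k → ℝ, ∀ B : ℝ, 0 ≤ B → (∀ b, g b ≤ B) → ∑ b, g b ≤ K * B := by
    intro g B hB0 hg
    calc ∑ b, g b ≤ ∑ b : Fin r × Fin k, B := Finset.sum_le_sum fun b _ => hg b
      _ = Fintype.card (Fin r × Fin k) * B := by simp
      _ ≤ K * B := by gcongr
  let E : Fin r × Fin k → Fin r × Fin k → Finset (Fin n) := fun a b =>
    (V a).filter (fun x => ∀ c, (Kgraph r k).Adj b c →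
      (d - ε / 4) * (p * (V c).card) ≤ ((nbhdIn G x (V c)).card : ℝ))
  have hrand := fun a b => random_sub (n := n) hq (fun w : Fin Δ → Fin n => commonNbhd Γ w Finset.univ Finset.univ) (E a b)
  choose S hSE hSc hSw using hrand
  have hEV : ∀ a b, E a b ⊆ V a := fun a b => Finset.filter_subset _ _
  have hSV : ∀ a b, S a b ⊆ V a := fun a b => (hSE a b).trans (hEV a b)
  have hfS : ∀ a b, f a b ≠ 0 → ∑ c, f a c ≤ (S a b).card := by
    intro a b hab
    have hD := hfD a b hab
    have h1 : (V a).card ≤ 2 * (E a b).card :=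
      eligible hp hε0 hε1 hε2 (hVpos a) hVpos b (fun c hc => hR a c (hD c hc))
    have h2 := hSc a b
    have h3 : ((V a).card : ℝ) ≤ 2 * (q * (S a b).card) := by
      exact_mod_cast h1.trans (Nat.mul_le_mul_left 2 h2)
    have h4 : (∑ c, (f a c : ℝ)) ≤ K * F := hsumle _ F hF0 (hfF a)
    have h5 := (hVlow a).trans h3
    rw [div_le_iff₀ (by positivity)] at h5
    have h6 : (16 * K * q) * (K * F) ≤ n := by
      calc (16 * K * q) * (K * F) = (16 * K * q * (K ^ 2 * (r₁ + 1)) * ξ) * n := by rw [hF]; ring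
        _ ≤ 1 * n := by gcongr
        _ = n := one_mul _
    have h7 : (16 * K * q) * (K * F) ≤ (16 * K * q) * (S a b).card := by linarith
    have h8 := le_of_mul_le_mul_left h7 (by positivity)
    exact_mod_cast h4.trans h8
  obtain ⟨V', T, hTS, hTc, hV'd, hV'u, hV'c, hV's, hV'm⟩ := repartition V hdis f S hSV hfS
  refine ⟨V', hV'd, hV'u, ?_, ?_, ?_, ?_⟩
  · intro a
    have h1 := hV'c a
    have h2 := hfd a
    zify at h1 ⊢
    linarith
  · intro a
    have h1 := (Finset.card_le_card (hV's a)).trans ((Finset.card_union_le _ _).trans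
      (Nat.add_le_add Finset.card_biUnion_le Finset.card_biUnion_le))
    have h2 : ((symmDiff (V a) (V' a)).card : ℝ) ≤ ∑ b, ((T a b).card : ℝ) + ∑ b, ((T b a).card : ℝ) := by exact_mod_cast h1
    have h3 := hsumle (fun b => ((T a b).card : ℝ)) F hF0 (fun b => by rw [hTc]; exact hfF a b)
    have h4 := hsumle (fun b => ((T b a).card : ℝ)) F hF0 (fun b => by rw [hTc]; exact hfF b a)
    calc _ ≤ K * F + K * F := by linarith
      _ = _ := by rw [hF]; ring
  · intro a c hac x hx
    rcases hV'm a x hx with h | ⟨b, -, h⟩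
    · exact hK a c hac x h
    · exact (Finset.mem_filter.mp (hSE b a h)).2 c hac
  · intro w a X hX
    have hX0 : 0 ≤ X := le_trans (by positivity) (hX a)
    have hcard : (Fintype.card (Fin Δ → Fin n) : ℝ) = (n : ℝ) ^ Δ := by simp
    have hL : 0 ≤ Real.log (q * n ^ Δ) := by
      apply Real.log_nonneg
      have : (1 : ℝ) ≤ n ^ Δ := one_le_pow₀ (by exact_mod_cast hn)
      nlinarith
    have hT : ∀ b c, ((commonNbhd Γ w Finset.univ Finset.univ ∩ T b c).card : ℝ) ≤ 2 / q * X + 2 * Real.log (q * n ^ Δ) := by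
      intro b c
      have h1 := hSw b c w
      rw [hcard] at h1
      have h2 : ((commonNbhd Γ w Finset.univ Finset.univ ∩ T b c).card : ℝ) ≤
          (commonNbhd Γ w Finset.univ Finset.univ ∩ S b c).card := by
        exact_mod_cast Finset.card_le_card (Finset.inter_subset_inter_left (hTS b c))
      have h3 : ((commonNbhd Γ w Finset.univ Finset.univ ∩ E b c).card : ℝ) ≤ X := by
        refine le_trans ?_ (hX b)
        have : commonNbhd Γ w Finset.univ Finset.univ ∩ E b c ⊆ commonNbhd Γ w Finset.univ (V b) := by
          intro y hy
          rw [Finset.mem_inter, mem_commonNbhd] at hy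
          rw [mem_commonNbhd]
          exact ⟨hEV b c hy.2, hy.1.2⟩
        exact_mod_cast Finset.card_le_card this
      have h4 : 2 / (q : ℝ) * ((commonNbhd Γ w Finset.univ Finset.univ ∩ E b c).card : ℝ) ≤ 2 / q * X := by gcongr
      linarith
    have hsub : commonNbhd Γ w Finset.univ (symmDiff (V a) (V' a)) ⊆
        Finset.univ.biUnion (fun b => commonNbhd Γ w Finset.univ Finset.univ ∩ T a b) ∪
        Finset.univ.biUnion (fun b => commonNbhd Γ w Finset.univ Finset.univ ∩ T b a) := by
      intro y hy
      rw [mem_commonNbhd] at hy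
      have h1 := hV's a hy.1
      simp only [Finset.mem_union, Finset.mem_biUnion, Finset.mem_univ, true_and, Finset.mem_inter, mem_commonNbhd] at h1 ⊢
      rcases h1 with ⟨b, hb⟩ | ⟨b, hb⟩
      · exact Or.inl ⟨b, fun j _ => hy.2 j (Finset.mem_univ _), hb⟩
      · exact Or.inr ⟨b, fun j _ => hy.2 j (Finset.mem_univ _), hb⟩
    have h1 := (Finset.card_le_card hsub).trans ((Finset.card_union_le _ _).trans
      (Nat.add_le_add Finset.card_biUnion_le Finset.card_biUnion_le))
    have h2 : ((commonNbhd Γ w Finset.univ (symmDiff (V a) (V' a))).card : ℝ) ≤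
      ∑ b, ((commonNbhd Γ w Finset.univ Finset.univ ∩ T a b).card : ℝ) +
      ∑ b, ((commonNbhd Γ w Finset.univ Finset.univ ∩ T b a).card : ℝ) := by exact_mod_cast h1
    have hY0 : 0 ≤ 2 / q * X + 2 * Real.log (q * n ^ Δ) := by positivity
    have h3 := hsumle _ _ hY0 (fun b => hT a b)
    have h4 := hsumle _ _ hY0 (fun b => hT b a)
    linarith

theorem nbhdIn_eq_common {n Δ : ℕ} (hΔ : 1 ≤ Δ) (Γ : SimpleGraph (Fin n)) (v : Fin n) (X : Finset (Fin n)) :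
    nbhdIn Γ v X = commonNbhd Γ (fun _ : Fin Δ => v) Finset.univ X := by
  ext y
  rw [mem_nbhdIn, mem_commonNbhd]
  constructor
  · rintro ⟨h1, h2⟩; exact ⟨h1, fun _ _ => h2⟩
  · rintro ⟨h1, h2⟩; exact ⟨h1, h2 ⟨0, hΔ⟩ (Finset.mem_univ _)⟩

theorem commonNbhd_pad {n s Δ : ℕ} (hs : 1 ≤ s) (hsΔ : s ≤ Δ) (Γ : SimpleGraph (Fin n)) (w : Fin s → Fin n) :
    ∃ w' : Fin Δ → Fin n, ∀ X, commonNbhd Γ w Finset.univ X = commonNbhd Γ w' Finset.univ X := by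
  refine ⟨fun t => w ⟨min t (s - 1), by omega⟩, fun X => ?_⟩
  ext y
  rw [mem_commonNbhd, mem_commonNbhd]
  constructor
  · rintro ⟨h1, h2⟩; exact ⟨h1, fun t _ => h2 _ (Finset.mem_univ _)⟩
  · rintro ⟨h1, h2⟩
    refine ⟨h1, fun t _ => ?_⟩
    have := h2 ⟨t, by omega⟩ (Finset.mem_univ _)
    have e : (⟨min (t : ℕ) (s - 1), by omega⟩ : Fin s) = t := Fin.ext (by simp; omega)
    simpa [e] using this

set_option maxHeartbeats 1000000 in
theorem balance_main {n r k r₁ Δ q : ℕ} {Γ G : SimpleGraph (Fin n)} (hG : G ≤ Γ)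
    {ε d p ξ μ δ C L : ℝ} (hq : 0 < q) (hk : 1 ≤ k) (hΔ : 1 ≤ Δ)
    (hr : r ≤ r₁) (hr0 : 0 < r) (hn : 0 < n) (hp : 0 < p) (hξ0 : 0 < ξ)
    (hε0 : 0 < ε) (hε1 : k * ε ≤ 1 / 2) (hε2 : ε ≤ 1 / 2) (hεd : ε < d)
    (hξ : 16 * ((k : ℝ) * r₁) * q * (((k : ℝ) * r₁) ^ 2 * (r₁ + 1)) * ξ ≤ 1)
    (hδ : δ = 1e-10 * ε ^ 4 * ((k : ℝ) ^ 2)⁻¹ * ((r₁ : ℝ) ^ 2)⁻¹)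
    (hξδ : 2 * (((k : ℝ) * r₁) ^ 2 * (r₁ + 1)) * ξ ≤ δ)
    (hξμ : 16 * ((k : ℝ) * r₁) * (((k : ℝ) * r₁) ^ 2 * (r₁ + 1)) * ξ ≤ μ)
    (hμ0 : 0 < μ) (hμ : μ * (1 + d) ≤ ε / 2)
    (hqδ : 2 * ((k : ℝ) * r₁) * (2 / q) ≤ δ)
    (hqμ : 2 * ((k : ℝ) * r₁) * (2 / q) * 40 ≤ μ / 2)
    (hlogC : 2 * ((k : ℝ) * r₁) * (2 * Real.log (q * n ^ Δ)) ≤ C * Real.log n)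
    (hlogp : 2 * ((k : ℝ) * r₁) * (2 * Real.log (q * n ^ Δ)) ≤ μ / 2 * (p * (n / (8 * (k * r₁)))))
    (hL : L = p * n / (16 * (k * r₁)))
    (U : Finset (Fin n)) (P : Fin r → Fin k → Finset (Fin n))
    (hdis : ∀ a b : Fin r × Fin k, a ≠ b → Disjoint (P a.1 a.2) (P b.1 b.2))
    (hU : Finset.univ.biUnion (fun a : Fin r × Fin k => P a.1 a.2) = U)
    (hsize : ∀ i j, (n : ℝ) / (8 * k * r) ≤ ((P i j).card : ℝ) ∧
              ((P i j).card : ℝ) ≤ 4 * n / (k * r))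
    (m : Fin r → Fin k → ℕ)
    (hm : (∑ i, ∑ j, m i j) = (∑ i, ∑ j, (P i j).card))
    {R : SimpleGraph (Fin r × Fin k)} (hB : Bgraph r k ≤ R) (hdeg : ∀ a, k * r < degV R a + r)
    (hB1 : ∀ i j, (m i j : ℝ) - ξ * n ≤ ((P i j).card : ℝ) ∧
              ((P i j).card : ℝ) ≤ (m i j : ℝ) + ξ * n)
    (hB4 : ∀ v ∈ U, ∀ i j,
            |((nbhdIn Γ v (P i j)).card : ℝ) - p * (P i j).card|
              ≤ (ε / 4) * (p * (P i j).card))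
    (pr0 pr : Finset (Fin n) → Finset (Fin n) → Prop)
    (hpr0 : ∀ X Y, pr0 X Y → LowerReg G (ε / 4) d p X Y)
    (htr : ∀ X Y X' Y', L ≤ X.card → L ≤ Y.card → Disjoint X Y → Disjoint X' Y' →
      ((symmDiff X X').card : ℝ) ≤ 2 * μ * X.card → ((symmDiff Y Y').card : ℝ) ≤ 2 * μ * Y.card →
      pr0 X Y → pr X' Y')
    (hR : ∀ a b : Fin r × Fin k, R.Adj a b → pr0 (P a.1 a.2) (P b.1 b.2))
    (hK : ∀ a b : Fin r × Fin k, (Kgraph r k).Adj a b →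
                pr0 (P a.1 a.2) (P b.1 b.2) ∧
                SuperDeg Γ G (ε / 4) d p (P a.1 a.2) (P b.1 b.2))
    (hN : ∀ v ∈ U, ∀ i : Fin r, ∀ j j' : Fin k, j ≠ j' →
                pr0 (nbhdIn Γ v (P i j)) (P i j') ∧
                pr0 (nbhdIn Γ v (P i j)) (nbhdIn Γ v (P i j'))) :
    BalConc Γ Δ r₁ pr (fun X Y => pr X Y ∧ SuperDeg Γ G ε d p X Y) R P U m ε C := by
  classical
  have hkR : (1 : ℝ) ≤ k := by exact_mod_cast hk
  have hrR : (r : ℝ) ≤ r₁ := by exact_mod_cast hr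
  have hr0R : (0 : ℝ) < r := by exact_mod_cast hr0
  have hr1R : (1 : ℝ) ≤ r₁ := by exact_mod_cast (by omega : 1 ≤ r₁)
  have hnR : (0 : ℝ) < n := by exact_mod_cast hn
  have hqR : (1 : ℝ) ≤ q := by exact_mod_cast hq
  set V : Fin r × Fin k → Finset (Fin n) := fun a => P a.1 a.2 with hV
  have hVlow : ∀ a, (n : ℝ) / (8 * (k * r₁)) ≤ (V a).card := by
    intro a
    refine le_trans ?_ (hsize a.1 a.2).1
    rw [mul_assoc 8]
    gcongr
  have hVU : ∀ a, V a ⊆ U := by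
    intro a x hx; rw [← hU]; exact Finset.mem_biUnion.mpr ⟨a, Finset.mem_univ _, hx⟩
  obtain ⟨V', hd', hu', hc', hs', hg', hw'⟩ := balance_core (Γ := Γ) (Δ := Δ) hq hk hr hr0 hn hp hξ0 hε0 hε1 (by linarith) hξ
    V hdis hVlow (fun a => m a.1 a.2)
    (by rw [Fintype.sum_prod_type, Fintype.sum_prod_type]; exact hm)
    (by
      intro a
      have := hB1 a.1 a.2
      rw [abs_le]
      constructor <;> linarith [this.1, this.2])
    hB hdeg (fun a b hab => hpr0 _ _ (hR a b hab))
    (by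
      intro a c hac x hx
      have h1 := (hK a c hac).2.1 x hx
      refine le_trans ?_ h1
      apply mul_le_mul_of_nonneg_left (le_max_left _ _)
      linarith)
  have hN1 : ∀ v ∈ U, ∀ a, ((nbhdIn Γ v (V a)).card : ℝ) ≤ (1 + ε / 4) * (p * (V a).card) := by
    intro v hv a
    have := (abs_le.mp (hB4 v hv a.1 a.2)).2
    simp only [hV]; linarith
  have hN2 : ∀ v ∈ U, ∀ a, 1 / 2 * (p * (V a).card) ≤ ((nbhdIn Γ v (V a)).card : ℝ) := by
    intro v hv a
    have := (abs_le.mp (hB4 v hv a.1 a.2)).1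
    have h0 : 0 ≤ p * ((V a).card : ℝ) := by positivity
    have : (1 - ε / 4) * (p * ((V a).card : ℝ)) ≤ ((nbhdIn Γ v (V a)).card : ℝ) := by simp only [hV]; linarith
    refine le_trans ?_ this
    gcongr
    linarith
  have hNL : ∀ v ∈ U, ∀ a, L ≤ ((nbhdIn Γ v (V a)).card : ℝ) := by
    intro v hv a
    refine le_trans ?_ (hN2 v hv a)
    rw [hL]
    have : p * (n : ℝ) / (16 * (k * r₁)) = 1 / 2 * (p * (n / (8 * (k * r₁)))) := by field_simp; norm_num
    rw [this]
    have := hVlow a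
    gcongr
  have hVL : ∀ a, L ≤ ((V a).card : ℝ) := by
    intro a
    have h1 : (0 : ℝ) < (V a).card := lt_of_lt_of_le (by positivity) (hVlow a)
    have h2 : 0 < (V a).card := by exact_mod_cast h1
    obtain ⟨v, hv⟩ := Finset.card_pos.mp h2
    refine (hNL v (hVU a hv) a).trans ?_
    have : nbhdIn Γ v (V a) ⊆ V a := fun y hy => (mem_nbhdIn.mp hy).1
    exact_mod_cast Finset.card_le_card this
  have hsμ : ∀ a, ((symmDiff (V a) (V' a)).card : ℝ) ≤ μ * (V a).card := by
    intro a
    refine (hs' a).trans ?_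
    calc 2 * (((k : ℝ) * r₁) ^ 2 * (r₁ + 1)) * ξ * n
        = (16 * ((k : ℝ) * r₁) * (((k : ℝ) * r₁) ^ 2 * (r₁ + 1)) * ξ) * (n / (8 * (k * r₁))) := by
          field_simp; norm_num
      _ ≤ μ * (V a).card := by
          have := hVlow a
          gcongr
  have hnμ : ∀ v ∈ U, ∀ a, ((nbhdIn Γ v (symmDiff (V a) (V' a))).card : ℝ) ≤ μ * (p * (V a).card) := by
    intro v hv a
    have h1 := hw' (fun _ => v) a (40 * (p * (V a).card)) (by
      intro b
      rw [← nbhdIn_eq_common hΔ]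
      refine (hN1 v hv b).trans ?_
      have e1 := (hsize b.1 b.2).2
      have e2 := (hsize a.1 a.2).1
      have e3 : 4 * (n : ℝ) / (k * r) = 32 * (n / (8 * k * r)) := by field_simp; norm_num
      have e4 : ((V b).card : ℝ) ≤ 32 * (V a).card := by simp only [hV]; linarith
      calc (1 + ε / 4) * (p * ((V b).card : ℝ)) ≤ (5 / 4) * (p * (32 * (V a).card)) := by
            gcongr; linarith
        _ = _ := by ring)
    rw [← nbhdIn_eq_common hΔ] at h1
    refine h1.trans ?_
    have h2 : μ / 2 * (p * (n / (8 * (k * r₁)))) ≤ μ / 2 * (p * (V a).card) := by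
      have := hVlow a
      gcongr
    have h0 : 0 ≤ p * ((V a).card : ℝ) := by positivity
    have h3 := mul_le_mul_of_nonneg_right hqμ h0
    calc _ = 2 * ((k : ℝ) * r₁) * (2 / q) * 40 * (p * (V a).card) + 2 * ((k : ℝ) * r₁) * (2 * Real.log (q * n ^ Δ)) := by ring
      _ ≤ μ / 2 * (p * (V a).card) + μ / 2 * (p * (V a).card) := by linarith
      _ = _ := by ring
  have hV'U : ∀ a, V' a ⊆ U := by
    intro a x hx; rw [← hU]
    rw [← hu']; exact Finset.mem_biUnion.mpr ⟨a, Finset.mem_univ _, hx⟩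
  have hs2 : ∀ a, ((symmDiff (V a) (V' a)).card : ℝ) ≤ 2 * μ * (V a).card := by
    intro a
    refine (hsμ a).trans ?_
    gcongr; linarith
  have hn2 : ∀ v ∈ U, ∀ a, ((symmDiff (nbhdIn Γ v (V a)) (nbhdIn Γ v (V' a))).card : ℝ) ≤ 2 * μ * (nbhdIn Γ v (V a)).card := by
    intro v hv a
    rw [← nbhdIn_symmDiff]
    refine (hnμ v hv a).trans ?_
    have := mul_le_mul_of_nonneg_left (hN2 v hv a) hμ0.le
    linarith
  have hnbsub : ∀ v (X : Finset (Fin n)), nbhdIn Γ v X ⊆ X := fun v X y hy => (mem_nbhdIn.mp hy).1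
  have hsd : ∀ a b, (Kgraph r k).Adj a b → ∀ x ∈ V' a,
      (d - ε) * max (p * (V' b).card) (((nbhdIn Γ x (V' b)).card : ℝ) / 2) ≤ ((nbhdIn G x (V' b)).card : ℝ) := by
    intro a b hab x hx
    exact superdeg_transfer hG hp hε0 hε2 hεd hμ0.le hμ (hg' a b hab x hx) (hN1 x (hV'U a hx) b)
      (hnμ x (hV'U a hx) b) (hsμ b)
  refine ⟨fun i j => V' (i, j), ?_, ?_, ?_, ?_, ?_, ?_, ?_, ?_⟩
  · intro a b hab; exact hd' a b hab
  · rw [← hU]; exact hu'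
  · intro i j; exact hc' (i, j)
  · intro i j
    rw [← hδ]
    refine (hs' (i, j)).trans ?_
    gcongr
  · intro a b hab
    exact htr _ _ _ _ (hVL a) (hVL b) (hdis a b hab.ne) (hd' a b hab.ne) (hs2 a) (hs2 b) (hR a b hab)
  · intro a b hab
    exact ⟨htr _ _ _ _ (hVL a) (hVL b) (hdis a b hab.ne) (hd' a b hab.ne) (hs2 a) (hs2 b) (hK a b hab).1,
      hsd a b hab, hsd b a hab.symm⟩
  · intro v hv i j j' hjj
    have hne : ((i, j) : Fin r × Fin k) ≠ (i, j') := by simpa using hjj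
    have h := hN v hv i j j' hjj
    have d1 := hdis _ _ hne
    have d2 := hd' _ _ hne
    refine ⟨htr _ _ _ _ (hNL v hv (i, j)) (hVL (i, j')) (Finset.disjoint_of_subset_left (hnbsub _ _) d1)
      (Finset.disjoint_of_subset_left (hnbsub _ _) d2) (hn2 v hv (i, j)) (hs2 (i, j')) h.1,
      htr _ _ _ _ (hNL v hv (i, j)) (hNL v hv (i, j'))
      (Finset.disjoint_of_subset_left (hnbsub _ _) (Finset.disjoint_of_subset_right (hnbsub _ _) d1))
      (Finset.disjoint_of_subset_left (hnbsub _ _) (Finset.disjoint_of_subset_right (hnbsub _ _) d2))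
      (hn2 v hv (i, j)) (hn2 v hv (i, j')) h.2⟩
  · intro s hs hsΔ w i j
    obtain ⟨w', hw⟩ := commonNbhd_pad hs hsΔ Γ w
    rw [← hδ, ← commonNbhd_symmDiff, hw, hw]
    have h1 := hw' w' (i, j) (commonNbhd Γ w' Finset.univ Finset.univ).card (by
      intro b
      have : commonNbhd Γ w' Finset.univ (V b) ⊆ commonNbhd Γ w' Finset.univ Finset.univ := by
        intro y hy
        rw [mem_commonNbhd] at hy ⊢
        exact ⟨Finset.mem_univ _, hy.2⟩
      exact_mod_cast Finset.card_le_card this)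
    refine h1.trans ?_
    have h0 : (0 : ℝ) ≤ (commonNbhd Γ w' Finset.univ Finset.univ).card := by positivity
    have h3 := mul_le_mul_of_nonneg_right hqδ h0
    linarith

theorem p_bound {n : ℕ} (hn : 3 ≤ n) {C p : ℝ} (hC : 0 < C)
    (hp : C * (Real.log n / n) ^ ((1 : ℝ) / 2) ≤ p) :
    1 ≤ Real.log n ∧ C * Real.log n ≤ p * n := by
  have hnR : (3 : ℝ) ≤ n := by exact_mod_cast hn
  have h1 : 1 ≤ Real.log n := by
    rw [Real.le_log_iff_exp_le (by linarith)]
    have := Real.exp_one_lt_d9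
    linarith
  refine ⟨h1, ?_⟩
  have h2 : Real.log n ≤ n := (Real.log_le_sub_one_of_pos (by linarith)).trans (by linarith)
  have h3 : 0 < Real.log n / n := by positivity
  have h4 : Real.log n / n ≤ 1 := by rw [div_le_one (by linarith)]; exact h2
  have h5 : Real.log n / n ≤ (Real.log n / n) ^ ((1 : ℝ) / 2) := by
    have := Real.rpow_le_rpow_of_exponent_ge h3 h4 (by norm_num : (1 : ℝ) / 2 ≤ 1)
    rwa [Real.rpow_one] at this
  have h6 : C * (Real.log n / n) ≤ p := le_trans (by gcongr) hp
  have h7 : C * Real.log n = C * (Real.log n / n) * n := by field_simp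
  rw [h7]
  gcongr

theorem deg_bound {r k D : ℕ} {γ : ℝ} (hγ : 0 < γ) (hk : 1 ≤ k) (hr : 0 < r)
    (h : (((k : ℝ) - 1) / k + γ / 2) * (k * r) ≤ (D : ℝ)) : k * r < D + r := by
  have hkR : (0 : ℝ) < k := by exact_mod_cast hk
  have hrR : (0 : ℝ) < r := by exact_mod_cast hr
  have e : (((k : ℝ) - 1) / k + γ / 2) * (k * r) = (k * r - r) + γ / 2 * (k * r) := by field_simp
  rw [e] at h
  have : 0 < γ / 2 * (k * r) := by positivity
  have : (k * r : ℝ) < D + r := by linarith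
  exact_mod_cast this

set_option maxHeartbeats 4000000 in
/-- **Balancing lemma** (Lemma 14 of "The bandwidth theorem in sparse graphs"). -/
theorem balancing_lemma (k r₁ Δ : ℕ) (hk : 1 ≤ k) (hr₁ : 1 ≤ r₁) (hΔ : 1 ≤ Δ)
    (γ d ε : ℝ) (hγ : 0 < γ) (hd : 0 < d) (hε0 : 0 < ε)
    (hε : ε < min d (1 / (2 * k))) :
    ∃ ξ Cstar : ℝ, 0 < ξ ∧ 0 < Cstar ∧
      ∃ N : ℕ, ∀ n : ℕ, N ≤ n →
        ∀ p : ℝ, Cstar * (Real.log n / n) ^ ((1 : ℝ) / 2) ≤ p →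
        ∀ r : ℕ, 10 / γ ≤ (r : ℝ) → r ≤ r₁ →
        ∀ Γ G : SimpleGraph (Fin n), G ≤ Γ →
        ∀ (U : Finset (Fin n)) (P : Fin r → Fin k → Finset (Fin n)),
          (∀ a b : Fin r × Fin k, a ≠ b → Disjoint (P a.1 a.2) (P b.1 b.2)) →
          (Finset.univ.biUnion (fun a : Fin r × Fin k => P a.1 a.2) = U) →
          (∀ i j, (n : ℝ) / (8 * k * r) ≤ ((P i j).card : ℝ) ∧
              ((P i j).card : ℝ) ≤ 4 * n / (k * r)) →
        ∀ m : Fin r → Fin k → ℕ,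
          (∑ i, ∑ j, m i j) = (∑ i, ∑ j, (P i j).card) →
        ∀ R : SimpleGraph (Fin r × Fin k), Bgraph r k ≤ R →
          (∀ a : Fin r × Fin k,
            (((k : ℝ) - 1) / k + γ / 2) * (k * r) ≤ (degV R a : ℝ)) →
          -- (B1)
          (∀ i j, (m i j : ℝ) - ξ * n ≤ ((P i j).card : ℝ) ∧
              ((P i j).card : ℝ) ≤ (m i j : ℝ) + ξ * n) →
          -- (B4)
          (∀ v ∈ U, ∀ i j,
            |((nbhdIn Γ v (P i j)).card : ℝ) - p * (P i j).card|
              ≤ (ε / 4) * (p * (P i j).card)) →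
          -- main conclusion, from the lower-regular hypotheses (B2), (B3)
          (((∀ a b : Fin r × Fin k, R.Adj a b →
                LowerReg G (ε / 4) d p (P a.1 a.2) (P b.1 b.2)) →
            (∀ a b : Fin r × Fin k, (Kgraph r k).Adj a b →
                LowerReg G (ε / 4) d p (P a.1 a.2) (P b.1 b.2) ∧
                SuperDeg Γ G (ε / 4) d p (P a.1 a.2) (P b.1 b.2)) →
            (∀ v ∈ U, ∀ i : Fin r, ∀ j j' : Fin k, j ≠ j' →
                LowerReg G (ε / 4) d p (nbhdIn Γ v (P i j)) (P i j') ∧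
                LowerReg G (ε / 4) d p (nbhdIn Γ v (P i j)) (nbhdIn Γ v (P i j'))) →
            BalConc Γ Δ r₁ (LowerReg G ε d p)
              (fun X Y => LowerReg G ε d p X Y ∧ SuperDeg Γ G ε d p X Y)
              R P U m ε Cstar) ∧
          -- "furthermore": the fully-regular version
          ((∀ A A' : Finset (Fin n), Disjoint A A' →
                ε ^ 2 * ξ * p * n / (50000 * k * r₁) ≤ (A.card : ℝ) →
                ε ^ 2 * ξ * p * n / (50000 * k * r₁) ≤ (A'.card : ℝ) →
                (eXY Γ A A' : ℝ) ≤ (1 + ε ^ 2 * ξ / 100) * p * A.card * A'.card) →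
            (∀ a b : Fin r × Fin k, R.Adj a b →
                Reg G (ε / 4) d p (P a.1 a.2) (P b.1 b.2)) →
            (∀ a b : Fin r × Fin k, (Kgraph r k).Adj a b →
                Reg G (ε / 4) d p (P a.1 a.2) (P b.1 b.2) ∧
                SuperDeg Γ G (ε / 4) d p (P a.1 a.2) (P b.1 b.2)) →
            (∀ v ∈ U, ∀ i : Fin r, ∀ j j' : Fin k, j ≠ j' →
                Reg G (ε / 4) d p (nbhdIn Γ v (P i j)) (P i j') ∧
                Reg G (ε / 4) d p (nbhdIn Γ v (P i j)) (nbhdIn Γ v (P i j'))) →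
            BalConc Γ Δ r₁ (Reg G ε d p)
              (fun X Y => Reg G ε d p X Y ∧ SuperDeg Γ G ε d p X Y)
              R P U m ε Cstar)) := by
  have hkR : (1 : ℝ) ≤ k := by exact_mod_cast hk
  have hr1R : (1 : ℝ) ≤ r₁ := by exact_mod_cast hr₁
  have hεd : ε < d := lt_of_lt_of_le hε (min_le_left _ _)
  have hεk : ε < 1 / (2 * k) := lt_of_lt_of_le hε (min_le_right _ _)
  have hε1 : k * ε ≤ 1 / 2 := by
    rw [lt_div_iff₀ (by positivity)] at hεk
    linarith
  have hε2 : ε ≤ 1 / 2 := by nlinarith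
  obtain ⟨K, hK⟩ : ∃ K : ℝ, K = (k : ℝ) * r₁ := ⟨_, rfl⟩
  have hK1 : 1 ≤ K := by rw [hK]; nlinarith
  obtain ⟨W, hW⟩ : ∃ W : ℝ, W = K ^ 2 * (r₁ + 1) := ⟨_, rfl⟩
  have hW1 : 1 ≤ W := by
    have : 1 ≤ K ^ 2 := one_le_pow₀ hK1
    rw [hW]; nlinarith
  obtain ⟨δ, hδ⟩ : ∃ δ : ℝ, δ = 1e-10 * ε ^ 4 * ((k : ℝ) ^ 2)⁻¹ * ((r₁ : ℝ) ^ 2)⁻¹ := ⟨_, rfl⟩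
  have hδ0 : 0 < δ := by rw [hδ]; positivity
  have hδ1 : δ ≤ 1 := by
    have h1 : ((k : ℝ) ^ 2)⁻¹ ≤ 1 := inv_le_one_of_one_le₀ (one_le_pow₀ hkR)
    have h2 : ((r₁ : ℝ) ^ 2)⁻¹ ≤ 1 := inv_le_one_of_one_le₀ (one_le_pow₀ hr1R)
    have h3 : ε ^ 4 ≤ 1 := pow_le_one₀ hε0.le (by linarith)
    rw [hδ]
    calc 1e-10 * ε ^ 4 * ((k : ℝ) ^ 2)⁻¹ * ((r₁ : ℝ) ^ 2)⁻¹ ≤ 1e-10 * 1 * 1 * 1 := by gcongr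
      _ ≤ 1 := by norm_num
  obtain ⟨μ, hμ⟩ : ∃ μ : ℝ, μ = ε ^ 2 / (400 * (1 + d)) := ⟨_, rfl⟩
  have hμ0 : 0 < μ := by rw [hμ]; positivity
  have hμd : μ * (1 + d) = ε ^ 2 / 400 := by rw [hμ]; field_simp
  have hμε : μ ≤ ε ^ 2 / 400 := by nlinarith
  have hμ1 : μ ≤ 1 := by nlinarith
  obtain ⟨q, hq⟩ : ∃ q : ℕ, q = ⌈320 * K / μ + 4 * K / δ⌉₊ + 1 := ⟨_, rfl⟩
  have hqR : 320 * K / μ + 4 * K / δ ≤ q := by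
    rw [hq]; push_cast
    have := Nat.le_ceil (320 * K / μ + 4 * K / δ)
    linarith
  have hq0 : 0 < q := by omega
  have hq1 : (1 : ℝ) ≤ q := by exact_mod_cast hq0
  have hqa : 320 * K ≤ q * μ := by
    rw [← div_le_iff₀ hμ0]
    have : 0 ≤ 4 * K / δ := by positivity
    linarith
  have hqb : 4 * K ≤ q * δ := by
    rw [← div_le_iff₀ hδ0]
    have : 0 ≤ 320 * K / μ := by positivity
    linarith
  obtain ⟨ξ, hξ⟩ : ∃ ξ : ℝ, ξ = μ * δ / (16 * K * q * W) := ⟨_, rfl⟩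
  have hξ0 : 0 < ξ := by rw [hξ]; positivity
  have hξe : 16 * K * q * W * ξ = μ * δ := by rw [hξ]; field_simp
  have hμδ : μ * δ ≤ μ := by nlinarith
  have hμδ' : μ * δ ≤ δ := by nlinarith
  have hξa : 16 * K * W * ξ ≤ μ * δ := by
    rw [← hξe]
    have : 0 ≤ 16 * K * W * ξ := by positivity
    nlinarith
  have hξb : 2 * W * ξ ≤ μ * δ := by
    refine le_trans ?_ hξa
    have : 0 ≤ W * ξ := by positivity
    nlinarith
  have hξμ : ξ ≤ μ := by
    have : ξ ≤ W * ξ := by nlinarith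
    nlinarith
  obtain ⟨C0, hC0⟩ : ∃ C0 : ℝ, C0 = 4 * K * (Δ + 1) := ⟨_, rfl⟩
  have hC00 : 0 < C0 := by rw [hC0]; positivity
  obtain ⟨C, hC⟩ : ∃ C : ℝ, C = C0 + 16 * K * C0 / μ + 8 * K / μ := ⟨_, rfl⟩
  have hCpos : 0 < C := by rw [hC]; positivity
  refine ⟨ξ, C, hξ0, hCpos, max q 3, ?_⟩
  intro n hn p hp r hrγ hrr Γ G hG U P hdis hU hsize m hm R hB hdeg hB1 hB4
  have hn3 : 3 ≤ n := le_trans (le_max_right _ _) hn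
  have hnq : q ≤ n := le_trans (le_max_left _ _) hn
  have hnR : (3 : ℝ) ≤ n := by exact_mod_cast hn3
  obtain ⟨hlog1, hpn⟩ := p_bound hn3 hCpos hp
  have hp0 : 0 < p := by
    have h1 : 0 < p * n := lt_of_lt_of_le (by positivity) hpn
    exact pos_of_mul_pos_left h1 (by positivity)
  have hr0 : 0 < r := by
    have h1 : (0 : ℝ) < r := lt_of_lt_of_le (by positivity) hrγ
    exact_mod_cast h1
  have hlogq : 2 * K * (2 * Real.log (q * n ^ Δ)) ≤ C0 * Real.log n := by
    have h1 : Real.log (q * n ^ Δ) ≤ (Δ + 1) * Real.log n := by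
      have h2 : Real.log ((q : ℝ) * n ^ Δ) ≤ Real.log ((n : ℝ) ^ (Δ + 1)) := by
        apply Real.log_le_log (by positivity)
        rw [pow_succ, mul_comm]
        have : (q : ℝ) ≤ n := by exact_mod_cast hnq
        gcongr
      rw [Real.log_pow] at h2
      push_cast at h2
      exact h2
    calc 2 * K * (2 * Real.log (q * n ^ Δ)) ≤ 2 * K * (2 * ((Δ + 1) * Real.log n)) := by gcongr
      _ = _ := by rw [hC0]; ring
  obtain ⟨L, hL⟩ : ∃ L : ℝ, L = p * n / (16 * K) := ⟨_, rfl⟩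
  have hL0 : 0 < L := by rw [hL]; positivity
  have hCa : 16 * K * C0 / μ * Real.log n ≤ p * n := by
    refine le_trans ?_ hpn
    rw [hC]
    apply mul_le_mul_of_nonneg_right _ (by linarith)
    have : 0 ≤ 8 * K / μ := by positivity
    linarith
  have hCb : 8 * K / μ ≤ p * n := by
    refine le_trans ?_ hpn
    have h1 : 8 * K / μ ≤ C := by
      rw [hC]
      have : 0 ≤ 16 * K * C0 / μ := by positivity
      linarith
    nlinarith
  have hlogp : C0 * Real.log n ≤ μ / 2 * (p * (n / (8 * K))) := by
    calc C0 * Real.log n = μ / (16 * K) * (16 * K * C0 / μ * Real.log n) := by field_simp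
      _ ≤ μ / (16 * K) * (p * n) := by gcongr
      _ = _ := by field_simp; norm_num
  have hL1 : 1 ≤ 2 * μ * L := by
    calc (1 : ℝ) = μ / (8 * K) * (8 * K / μ) := by field_simp
      _ ≤ μ / (8 * K) * (p * n) := by gcongr
      _ = _ := by rw [hL]; field_simp; norm_num
  have hLτ : ε ^ 2 * ξ * p * n / (50000 * k * r₁) ≤ 2 * μ * L := by
    have e1 : ε ^ 2 * ξ * p * n / (50000 * k * r₁) = (ε ^ 2 * ξ / 50000) * (p * n / K) := by
      rw [hK]; field_simp
    have e2 : 2 * μ * L = (μ / 8) * (p * n / K) := by rw [hL]; field_simp; norm_num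
    rw [e1, e2]
    apply mul_le_mul_of_nonneg_right _ (by positivity)
    have : ε ^ 2 * ξ ≤ 1 * ξ := by
      gcongr
      exact pow_le_one₀ hε0.le (by linarith)
    linarith
  have hCC : C0 * Real.log n ≤ C * Real.log n := by
    apply mul_le_mul_of_nonneg_right _ (by linarith)
    rw [hC]
    have : 0 ≤ 16 * K * C0 / μ + 8 * K / μ := by positivity
    linarith
  have hdegN : ∀ a, k * r < degV R a + r := fun a => deg_bound hγ hk hr0 (hdeg a)
  have hqδ : 2 * K * (2 / q) ≤ δ := by
    have : 2 * K * (2 / q) = 4 * K / q := by ring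
    rw [this, div_le_iff₀ (by positivity)]; linarith
  have hqμ : 2 * K * (2 / q) * 40 ≤ μ / 2 := by
    have : 2 * K * (2 / q) * 40 = 160 * K / q := by ring
    rw [this, div_le_iff₀ (by positivity)]; linarith
  have hμε2 : μ * (1 + d) ≤ ε / 2 := by rw [hμd]; nlinarith
  have main := balance_main (Γ := Γ) (C := C) (δ := δ) (μ := μ) (L := L) (q := q) (Δ := Δ) (r₁ := r₁)
    hG hq0 hk hΔ hrr hr0 (by omega) hp0 hξ0 hε0 hε1 hε2 hεd
    (by rw [← hK, ← hW, hξe]; linarith) hδ (by rw [← hK, ← hW]; linarith)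
    (by rw [← hK, ← hW]; linarith) hμ0 hμε2
    (by rw [← hK]; exact hqδ) (by rw [← hK]; exact hqμ) (by rw [← hK]; exact hlogq.trans hCC)
    (by rw [← hK]; exact hlogq.trans hlogp) (by rw [← hK]; exact hL)
    U P hdis hU hsize m hm hB hdegN hB1 hB4
  constructor
  · intro hR hKr hN
    refine main (LowerReg G (ε / 4) d p) (LowerReg G ε d p) (fun X Y h => h) ?_ hR hKr hN
    intro X Y X' Y' hX hY _ _ hXs hYs h
    have hX0 : 0 < X.card := by
      have : (0 : ℝ) < X.card := lt_of_lt_of_le hL0 hX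
      exact_mod_cast this
    have hY0 : 0 < Y.card := by
      have : (0 : ℝ) < Y.card := lt_of_lt_of_le hL0 hY
      exact_mod_cast this
    exact LowerReg.transfer (μ := 2 * μ) hp0 hε0 hε2 hεd (by linarith) (by linarith)
      (by nlinarith) hX0 hY0 hXs hYs h
  · intro hΓ hR hKr hN
    refine main (Reg G (ε / 4) d p) (Reg G ε d p) (fun X Y h => h.lower) ?_ hR hKr hN
    intro X Y X' Y' hX hY hd1 hd2 hXs hYs h
    have hLX : 2 * μ * L ≤ 2 * μ * X.card := by gcongr
    have hLY : 2 * μ * L ≤ 2 * μ * Y.card := by gcongr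
    refine Reg.transfer (Γ := Γ) (τ := ε ^ 2 * ξ * p * n / (50000 * k * r₁)) hG (μ := 2 * μ) hp0 hε0 hε2 hεd (by linarith) (by linarith)
      (by linarith) (by linarith) (by linarith) (by linarith) hd1 hd2 ?_ hXs hYs h
    intro A A' hAA h1 h2
    refine (hΓ A A' hAA h1 h2).trans ?_
    have : 1 + ε ^ 2 * ξ / 100 ≤ 2 := by
      have e1 : ε ^ 2 ≤ 1 := pow_le_one₀ hε0.le (by linarith)
      have e2 : ε ^ 2 * ξ ≤ 1 * 1 := by gcongr; linarith
      linarith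
    gcongr
end

section
/- For each η > 0 and Δ there exists C such that the following holds. Let W ⊆ [n], let t ≤ 100n^Δ, and let T₁,…,T_t be subsets of W. Then for each m ≤ |W| there is a set S ⊆ W of size m such that |T_i ∩ S| = (m/|W|)·|T_i| ± (η|T_i| + C log n) for every i ∈ [t]. -/
open Filter

theorem choose_ratio_bound (j : ℕ) : ∀ N m : ℕ, j ≤ m → m ≤ N →
    ((N - j).choose (m - j) : ℝ) ≤ (N.choose m : ℝ) * ((m : ℝ) / N) ^ j := by
  induction j with
  | zero => intro N m _ _; simp
  | succ j ih =>
    intro N m hj hm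
    obtain ⟨m, rfl⟩ : ∃ k, m = k + 1 := ⟨m - 1, by omega⟩
    obtain ⟨N, rfl⟩ : ∃ k, N = k + 1 := ⟨N - 1, by omega⟩
    have h1 := ih N m (by omega) (by omega)
    have e1 : N + 1 - (j + 1) = N - j := by omega
    have e2 : m + 1 - (j + 1) = m - j := by omega
    rw [e1, e2]
    have h2 : (m : ℝ) / N ≤ ((m + 1 : ℕ) : ℝ) / ((N + 1 : ℕ) : ℝ) := by
      rcases Nat.eq_zero_or_pos N with h0 | h0
      · subst h0; simp; positivity
      · have : (0:ℝ) < N := by exact_mod_cast h0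
        have hmN : (m : ℝ) ≤ N := by exact_mod_cast (by omega : m ≤ N)
        rw [div_le_div_iff₀ this (by positivity)]
        push_cast; nlinarith
    have h3 : (N.choose m : ℝ) = ((N + 1).choose (m + 1) : ℝ) * (((m + 1 : ℕ) : ℝ) / ((N + 1 : ℕ) : ℝ)) := by
      have := Nat.add_one_mul_choose_eq N m
      have h' : ((N + 1 : ℕ) : ℝ) * (N.choose m : ℝ) = ((N + 1).choose (m + 1) : ℝ) * ((m + 1 : ℕ) : ℝ) := by
        exact_mod_cast this
      have hN : ((N + 1 : ℕ) : ℝ) ≠ 0 := by positivity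
      field_simp
      linarith
    calc ((N - j).choose (m - j) : ℝ) ≤ (N.choose m : ℝ) * ((m : ℝ) / N) ^ j := h1
      _ ≤ (N.choose m : ℝ) * (((m + 1 : ℕ) : ℝ) / ((N + 1 : ℕ) : ℝ)) ^ j := by gcongr
      _ = _ := by rw [h3]; ring

theorem card_superset_bound {α : Type*} [DecidableEq α] (W J : Finset α) (hJ : J ⊆ W) (m : ℕ)
    (hm : m ≤ W.card) :
    (((W.powersetCard m).filter (fun S => J ⊆ S)).card : ℝ)
      ≤ (W.card.choose m : ℝ) * ((m : ℝ) / W.card) ^ J.card := by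
  by_cases hj : J.card ≤ m
  · refine le_trans ?_ (choose_ratio_bound J.card W.card m hj hm)
    have : ((W.powersetCard m).filter (fun S => J ⊆ S)).card
        ≤ ((W \ J).powersetCard (m - J.card)).card := by
      apply Finset.card_le_card_of_injOn (fun S => S \ J)
      · intro S hS
        simp only [Finset.coe_filter, Finset.mem_powersetCard, Set.mem_ofPred_eq] at hS
        simp only [Finset.mem_coe, Finset.mem_powersetCard]
        exact ⟨Finset.sdiff_subset_sdiff hS.1.1 le_rfl, by
          rw [Finset.card_sdiff_of_subset hS.2, hS.1.2]⟩
      · intro S hS S' hS' h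
        simp only [Finset.coe_filter, Finset.mem_powersetCard, Set.mem_ofPred_eq] at hS hS'
        simp only at h
        rw [← Finset.sdiff_union_of_subset hS.2, h, Finset.sdiff_union_of_subset hS'.2]
    rw [Finset.card_powersetCard, Finset.card_sdiff_of_subset hJ] at this
    exact_mod_cast this
  · have : (W.powersetCard m).filter (fun S => J ⊆ S) = ∅ := by
      apply Finset.filter_eq_empty_iff.2
      intro S hS h
      rw [Finset.mem_powersetCard] at hS
      have := Finset.card_le_card h
      omega
    rw [this]; simp; positivity

theorem hyper_mgf {α : Type*} [DecidableEq α] (W T : Finset α) (hT : T ⊆ W) (m : ℕ)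
    (hm : m ≤ W.card) (x : ℝ) (hx : 0 ≤ x) :
    ∑ S ∈ W.powersetCard m, (1 + x) ^ (T ∩ S).card
      ≤ (W.card.choose m : ℝ) * (1 + (m : ℝ) / W.card * x) ^ T.card := by
  have h1 : ∀ S : Finset α, (1 + x) ^ (T ∩ S).card
      = ∑ J ∈ T.powerset, if J ⊆ S then x ^ J.card else 0 := by
    intro S
    rw [← Finset.prod_const, Finset.prod_one_add, ← Finset.sum_filter]
    have : T.powerset.filter (fun J => J ⊆ S) = (T ∩ S).powerset := by
      ext J; simp only [Finset.mem_filter, Finset.mem_powerset, Finset.subset_inter_iff]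
    rw [this]
    simp
  simp_rw [h1]
  rw [Finset.sum_comm]
  rw [← Finset.prod_const, Finset.prod_one_add, Finset.mul_sum]
  apply Finset.sum_le_sum
  intro J hJ
  have hJW : J ⊆ W := (Finset.mem_powerset.1 hJ).trans hT
  rw [← Finset.sum_filter, Finset.sum_const, Finset.prod_const, nsmul_eq_mul, mul_pow, ← mul_assoc]
  gcongr
  exact card_superset_bound W J hJW m hm

theorem hyper_tail {α : Type*} [DecidableEq α] (W T : Finset α) (hT : T ⊆ W) (m : ℕ)
    (hm : m ≤ W.card) (η L a : ℝ) (hL : 0 < L) (hL1 : L ≤ 1) (hLη : L ≤ η) :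
    (((W.powersetCard m).filter (fun S =>
      (m : ℝ) / W.card * T.card + (η * T.card + a) < ((T ∩ S).card : ℝ))).card : ℝ)
      ≤ (W.card.choose m : ℝ) * Real.exp (- (L * a)) := by
  set p : ℝ := (m : ℝ) / W.card with hp
  have hp0 : 0 ≤ p := by positivity
  have hp1 : p ≤ 1 := div_le_one_of_le₀ (by exact_mod_cast hm) (by positivity)
  set B := (W.powersetCard m).filter (fun S =>
      p * T.card + (η * T.card + a) < ((T ∩ S).card : ℝ)) with hB
  set θ := p * T.card + (η * T.card + a) with hθ
  have hexp : Real.exp L - 1 ≤ L + L ^ 2 := by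
    have := Real.abs_exp_sub_one_sub_id_le (x := L) (by rw [abs_of_pos hL]; exact hL1)
    have := (abs_le.1 this).2
    linarith
  have hx : 0 ≤ Real.exp L - 1 := by
    have := Real.add_one_le_exp L
    linarith
  have h1 := hyper_mgf W T hT m hm (Real.exp L - 1) hx
  have h2 : (B.card : ℝ) * Real.exp (L * θ) ≤ ∑ S ∈ W.powersetCard m, (1 + (Real.exp L - 1)) ^ (T ∩ S).card := by
    calc (B.card : ℝ) * Real.exp (L * θ) = ∑ S ∈ B, Real.exp (L * θ) := by simp
      _ ≤ ∑ S ∈ B, (1 + (Real.exp L - 1)) ^ (T ∩ S).card := by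
        apply Finset.sum_le_sum
        intro S hS
        have := (Finset.mem_filter.1 hS).2
        rw [add_sub_cancel, ← Real.exp_nat_mul, mul_comm]
        apply Real.exp_le_exp.2
        gcongr
      _ ≤ _ := by
        apply Finset.sum_le_sum_of_subset_of_nonneg (Finset.filter_subset _ _)
        intros; rw [add_sub_cancel]; positivity
  have h3 : (1 + p * (Real.exp L - 1)) ^ T.card ≤ Real.exp (L * θ) * Real.exp (-(L * a)) := by
    calc (1 + p * (Real.exp L - 1)) ^ T.card ≤ (Real.exp (L * (p + η))) ^ T.card := by
          gcongr
          have := Real.add_one_le_exp (p * (Real.exp L - 1))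
          have h5 : p * (Real.exp L - 1) ≤ L * (p + η) := by nlinarith
          have := Real.exp_le_exp.2 h5
          linarith
      _ = _ := by
        rw [← Real.exp_nat_mul, ← Real.exp_add]; congr 1; rw [hθ]; ring
  have h4 : (B.card : ℝ) * Real.exp (L * θ) ≤ ((W.card.choose m : ℝ) * Real.exp (-(L * a))) * Real.exp (L * θ) := by
    refine h2.trans (h1.trans ?_)
    calc _ ≤ (W.card.choose m : ℝ) * (Real.exp (L * θ) * Real.exp (-(L * a))) := by gcongr
      _ = _ := by ring
  exact le_of_mul_le_mul_right h4 (Real.exp_pos _)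

theorem hyper_tail_lower {α : Type*} [DecidableEq α] (W T : Finset α) (hT : T ⊆ W) (m : ℕ)
    (hm : m ≤ W.card) (hW : 0 < W.card) (η L a : ℝ) (hL : 0 < L) (hL1 : L ≤ 1) (hLη : L ≤ η) :
    (((W.powersetCard m).filter (fun S =>
      ((T ∩ S).card : ℝ) < (m : ℝ) / W.card * T.card - (η * T.card + a))).card : ℝ)
      ≤ (W.card.choose m : ℝ) * Real.exp (- (L * a)) := by
  have h := hyper_tail W T hT (W.card - m) (Nat.sub_le _ _) η L a hL hL1 hLη
  rw [Nat.choose_symm hm] at h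
  refine le_trans ?_ h
  norm_cast
  apply Finset.card_le_card_of_injOn (fun S => W \ S)
  · intro S hS
    simp only [Finset.coe_filter, Finset.mem_powersetCard, Set.mem_ofPred_eq] at hS ⊢
    obtain ⟨⟨hSW, hSm⟩, h3⟩ := hS
    refine ⟨⟨Finset.sdiff_subset, by rw [Finset.card_sdiff_of_subset hSW, hSm]⟩, ?_⟩
    have e : T ∩ (W \ S) = T \ S := by
      ext y; simp only [Finset.mem_inter, Finset.mem_sdiff]
      exact ⟨fun h => ⟨h.1, h.2.2⟩, fun h => ⟨h.1, hT h.1, h.2⟩⟩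
    have e2 : ((T ∩ S).card : ℝ) + ((T \ S).card : ℝ) = T.card := by
      exact_mod_cast Finset.card_inter_add_card_sdiff T S
    rw [e, Nat.cast_sub hm, sub_div, div_self (by positivity)]
    linarith
  · intro S hS S' hS' h
    simp only [Finset.coe_filter, Finset.mem_powersetCard, Set.mem_ofPred_eq] at hS hS'
    simp only at h
    rw [← Finset.sdiff_sdiff_eq_self hS.1.1, h, Finset.sdiff_sdiff_eq_self hS'.1.1]

/-- **Lemma 17** of "The bandwidth theorem in sparse graphs": a set of any prescribed
size intersecting many given sets proportionally. -/
theorem proportional_subset_lemma (η : ℝ) (hη : 0 < η) (Δ : ℕ) :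
    ∃ C : ℝ, 0 < C ∧
      ∀ n : ℕ, ∀ W : Finset (Fin n), ∀ t : ℕ, (t : ℝ) ≤ 100 * (n : ℝ) ^ Δ →
        ∀ T : Fin t → Finset (Fin n), (∀ i, T i ⊆ W) →
          ∀ m : ℕ, m ≤ W.card →
            ∃ S : Finset (Fin n), S ⊆ W ∧ S.card = m ∧
              ∀ i : Fin t,
                |((T i ∩ S).card : ℝ) - (m : ℝ) / W.card * (T i).card|
                  ≤ η * (T i).card + C * Real.log n := by
  set L := min η 1 with hLdef
  have hL : 0 < L := lt_min hη one_pos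
  refine ⟨(Δ + 8 : ℕ) / L, by positivity, ?_⟩
  intro n W t ht T hT m hm
  have hlog : 0 ≤ Real.log n := Real.log_natCast_nonneg n
  have hWn : W.card ≤ n := by simpa using Finset.card_le_univ W
  rcases Nat.eq_zero_or_pos m with hm0 | hm0
  · refine ⟨∅, Finset.empty_subset _, by simp [hm0], fun i => ?_⟩
    simp only [hm0, Finset.inter_empty, Finset.card_empty, Nat.cast_zero, zero_div, zero_mul,
      sub_self, abs_zero]
    positivity
  rcases eq_or_lt_of_le hm with hmW | hmW
  · refine ⟨W, le_rfl, hmW.symm, fun i => ?_⟩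
    have : (W.card : ℝ) ≠ 0 := by exact_mod_cast (by omega : W.card ≠ 0)
    rw [Finset.inter_eq_left.2 (hT i), hmW, div_self this, one_mul, sub_self, abs_zero]
    positivity
  have hn : 2 ≤ n := by omega
  have hn0 : (0:ℝ) < n := by exact_mod_cast (by omega : 0 < n)
  set a := ((Δ + 8 : ℕ) : ℝ) / L * Real.log n with ha
  have hLa : Real.exp (-(L * a)) = ((n : ℝ) ^ (Δ + 8))⁻¹ := by
    rw [Real.exp_neg, ha, ← mul_assoc, mul_div_cancel₀ _ hL.ne', ← Real.log_pow,
      Real.exp_log (by positivity)]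
  by_contra hcon
  push Not at hcon
  let U : Fin t → Finset (Finset (Fin n)) := fun i => (W.powersetCard m).filter (fun S =>
      (m : ℝ) / W.card * (T i).card + (η * (T i).card + a) < ((T i ∩ S).card : ℝ))
  let D : Fin t → Finset (Finset (Fin n)) := fun i => (W.powersetCard m).filter (fun S =>
      ((T i ∩ S).card : ℝ) < (m : ℝ) / W.card * (T i).card - (η * (T i).card + a))
  have hcover : W.powersetCard m ⊆ Finset.univ.biUnion (fun i => U i ∪ D i) := by
    intro S hS
    have hS' := Finset.mem_powersetCard.1 hS
    obtain ⟨i, hi⟩ := hcon S hS'.1 hS'.2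
    simp only [Finset.mem_biUnion, Finset.mem_univ, true_and, Finset.mem_union]
    refine ⟨i, ?_⟩
    rcases lt_abs.1 hi with h | h
    · left; exact Finset.mem_filter.2 ⟨hS, by linarith⟩
    · right; exact Finset.mem_filter.2 ⟨hS, by linarith⟩
  have h1 : (W.card.choose m : ℝ) ≤ ∑ i : Fin t, (((U i).card : ℝ) + (D i).card) := by
    have h := (Finset.card_le_card hcover).trans (Finset.card_biUnion_le.trans
      (Finset.sum_le_sum fun i _ => Finset.card_union_le (U i) (D i)))
    rw [Finset.card_powersetCard] at h
    exact_mod_cast h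
  have h2 : ∑ i : Fin t, (((U i).card : ℝ) + (D i).card)
      ≤ ∑ i : Fin t, 2 * ((W.card.choose m : ℝ) * Real.exp (-(L * a))) := by
    apply Finset.sum_le_sum
    intro i _
    have hu := hyper_tail W (T i) (hT i) m hm η L a hL (min_le_right _ _) (min_le_left _ _)
    have hd := hyper_tail_lower W (T i) (hT i) m hm (by omega) η L a hL (min_le_right _ _)
      (min_le_left _ _)
    show (((W.powersetCard m).filter _).card : ℝ) + ((W.powersetCard m).filter _).card ≤ _
    linarith
  rw [Finset.sum_const, Finset.card_univ, Fintype.card_fin, nsmul_eq_mul, hLa] at h2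
  have hc : (0:ℝ) < W.card.choose m := by exact_mod_cast Nat.choose_pos hm
  have h3 : (1:ℝ) ≤ t * 2 * ((n : ℝ) ^ (Δ + 8))⁻¹ := by
    have := h1.trans h2
    by_contra hlt
    push Not at hlt
    nlinarith
  rw [← div_eq_mul_inv, one_le_div (by positivity), pow_add] at h3
  have h8 : (256:ℝ) ≤ (n:ℝ) ^ 8 := by
    calc (256:ℝ) = 2 ^ 8 := by norm_num
      _ ≤ _ := by gcongr; exact_mod_cast hn
  have hpos : (0:ℝ) < (n:ℝ) ^ Δ := by positivity
  nlinarith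
end
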